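/- arXiv:1507.06502 — 3 statements merged into one kernel-verified Lean document; each statement's English description precedes it below -/
import Mathlib

section
/- Let 𝔄 be a commutative ring, let A, B ∈ 𝔄[X] be monic of the same degree d, and for 0 ≤ j ≤ d−1 let R_j be the j-th subresultant and r_j the j-th principal subresultant of (A,B) computed in degree (d,d). Then for all 1 ≤ j ≤ d−1 and all 0 ≤ k < j, the k-th subresultant of the pair (R_j, R_{j−1}) computed in degree (j, j−1) equals r_j^{2(j−k−1)} · R_k. -/
open Polynomial MeasureTheory ProbabilityTheory
open scoped ENNReal NNReal

/-- The `i`-th row polynomial of the (truncated) Sylvester matrix of `A` and `B`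
computed in degree `(dA, dB)` and truncation level `j`. -/
noncomputable def subresRowPoly {R : Type*} [CommRing R] (dA dB j : ℕ) (A B : R[X])
    (i : ℕ) : R[X] :=
  if i < dB - j then X ^ (dB - j - 1 - i) * A
  else X ^ (dA - j - 1 - (i - (dB - j))) * B

/-- The truncated Sylvester-type matrix of `A`, `B` in degree `(dA, dB)`, truncation level `j`,
with a prescribed last column `lastCol`. -/
noncomputable def subresMatrix {R : Type*} [CommRing R] (dA dB j : ℕ) (A B : R[X])
    (lastCol : ℕ → R) : Matrix (Fin (dA + dB - 2 * j)) (Fin (dA + dB - 2 * j)) R :=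
  Matrix.of fun i c =>
    if (c : ℕ) < dA + dB - 2 * j - 1 then
      (subresRowPoly dA dB j A B i).coeff (dA + dB - j - 1 - (c : ℕ))
    else lastCol i

/-- The `j`-th principal subresultant of `A` and `B` computed in degree `(dA, dB)`:
the determinant of the truncated Sylvester map `ψ_j` in the canonical monomial bases. -/
noncomputable def principalSubres {R : Type*} [CommRing R] (dA dB j : ℕ) (A B : R[X]) : R :=
  (subresMatrix dA dB j A B fun i => (subresRowPoly dA dB j A B i).coeff j).det

/-- The `j`-th subresultant `R_j = Res_j^{dA,dB}(A,B)` of `A` and `B`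
computed in degree `(dA, dB)`. -/
noncomputable def subresultant {R : Type*} [CommRing R] (dA dB j : ℕ) (A B : R[X]) : R[X] :=
  ∑ k ∈ Finset.range (j + 1),
    C ((subresMatrix dA dB j A B fun i => (subresRowPoly dA dB j A B i).coeff k).det) * X ^ k

/-- The signed maximal minor (cofactor w.r.t. the last column and row `u`) of the truncated
Sylvester matrix. -/
noncomputable def cofactorMinor {R : Type*} [CommRing R] (dA dB j : ℕ) (A B : R[X])
    (u : ℕ) : R :=
  (subresMatrix dA dB j A B fun i => if (i : ℕ) = u then 1 else 0).det

/-- The `j`-th cofactor `U_j^{dA,dB}(A,B)` (of `A`), obtained by Cramer's formulas: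
it satisfies `A * U_j + B * V_j = Res_j(A,B)`. -/
noncomputable def cofactorU {R : Type*} [CommRing R] (dA dB j : ℕ) (A B : R[X]) : R[X] :=
  ∑ u ∈ Finset.range (dB - j), C (cofactorMinor dA dB j A B u) * X ^ (dB - j - 1 - u)

/-- The `j`-th cofactor `V_j^{dA,dB}(A,B)` (of `B`), obtained by Cramer's formulas. -/
noncomputable def cofactorV {R : Type*} [CommRing R] (dA dB j : ℕ) (A B : R[X]) : R[X] :=
  ∑ v ∈ Finset.range (dA - j), C (cofactorMinor dA dB j A B (dB - j + v)) * X ^ (dA - j - 1 - v)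


namespace Subres

open Finset

section RowDet

variable {R : Type*} [CommRing R]

/-- The rows `X ^ (a - 1) * P, …, P, X ^ (b - 1) * Q, …, Q`. -/
noncomputable def sylRow (a b : ℕ) (P Q : R[X]) (i : ℕ) : R[X] :=
  if i < a then X ^ (a - 1 - i) * P else X ^ (b - 1 - (i - a)) * Q

/-- The determinant whose `i`-th row consists of the coefficients of `f i` from degree `N`
downwards, followed by the coefficient of degree `e`. -/
noncomputable def rowDet (n N e : ℕ) (f : ℕ → R[X]) : R :=
  (Matrix.of fun i c : Fin n =>
    if (c : ℕ) < n - 1 then (f i).coeff (N - c) else (f i).coeff e).det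

theorem rowDet_congr {n N e : ℕ} {f g : ℕ → R[X]} (h : ∀ i < n, f i = g i) :
    rowDet n N e f = rowDet n N e g := by
  unfold rowDet
  congr 1
  ext i c
  simp [h i i.2]

theorem rowDet_linear {n N e : ℕ} {f g : ℕ → R[X]} (T : Matrix (Fin n) (Fin n) R)
    (h : ∀ i : Fin n, g i = ∑ l : Fin n, C (T i l) * f l) :
    rowDet n N e g = T.det * rowDet n N e f := by
  unfold rowDet
  rw [← Matrix.det_mul]
  congr 1
  ext i c
  simp only [Matrix.of_apply, Matrix.mul_apply, h i, finsetSum_coeff, coeff_C_mul]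
  split_ifs <;> rfl

theorem rowDet_succ {n N e : ℕ} (hn : 1 ≤ n) {f : ℕ → R[X]}
    (h : ∀ i < n, (f (i + 1)).coeff (N + 1) = 0) :
    rowDet (n + 1) (N + 1) e f = (f 0).coeff (N + 1) * rowDet n N e fun i => f (i + 1) := by
  unfold rowDet
  rw [Matrix.det_succ_column_zero, Fin.sum_univ_succ, Finset.sum_eq_zero]
  · have h0 : 0 < n := hn
    simp only [Fin.val_zero, pow_zero, one_mul, Matrix.of_apply, add_zero, Nat.add_sub_cancel,
      h0, if_true, Nat.sub_zero]
    congr 2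
    ext i c
    have hc : (c : ℕ) + 1 < n ↔ (c : ℕ) < n - 1 := by omega
    simp [hc]
  · intro i _
    have h0 : 0 < n := hn
    simp [h0, h i i.2]

theorem rowDet_sylRow_C_mul_right (a b N e : ℕ) (c : R) (P Q : R[X]) :
    rowDet (a + b) N e (sylRow a b P (C c * Q)) =
      c ^ b * rowDet (a + b) N e (sylRow a b P Q) := by
  rw [rowDet_linear (f := sylRow a b P Q)
    (Matrix.diagonal fun i : Fin (a + b) => if (i : ℕ) < a then 1 else c)]
  · rw [Matrix.det_diagonal, Fin.prod_univ_add]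
    simp
  · intro i
    rw [Finset.sum_eq_single i]
    · simp only [Matrix.diagonal_apply_eq, sylRow]
      split_ifs
      · simp
      · ring
    · intro l _ hl
      simp [Matrix.diagonal_apply_ne _ hl.symm]
    · simp

theorem rowDet_sylRow_add_mul_left {a b : ℕ} (N e : ℕ) (c : R) (P Q H : R[X])
    (hH : H.natDegree + a ≤ b) :
    rowDet (a + b) N e (sylRow a b (C c * P + H * Q) Q) =
      c ^ a * rowDet (a + b) N e (sylRow a b P Q) := by
  rw [rowDet_linear (f := sylRow a b P Q) (Matrix.of fun i l : Fin (a + b) =>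
    if (l : ℕ) = i then if (i : ℕ) < a then c else 1
    else if (i : ℕ) < a ∧ a ≤ (l : ℕ) then (X ^ (a - 1 - i) * H).coeff (b - 1 - (l - a)) else 0)]
  · rw [Matrix.det_of_isUpperTriangular]
    · simp [Fin.prod_univ_add]
    · intro i l hl
      have hl' : (l : ℕ) < i := hl
      have h1 : ¬ ((l : ℕ) = i) := by omega
      have h2 : ¬ ((i : ℕ) < a ∧ a ≤ (l : ℕ)) := by omega
      simp [h1, h2]
  · intro i
    by_cases hi : (i : ℕ) < a
    · have hdeg : (X ^ (a - 1 - i) * H : R[X]).natDegree < b := by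
        refine (natDegree_mul_le.trans (Nat.add_le_add_right (natDegree_X_pow_le _) _)).trans_lt ?_
        omega
      have hsum : ∑ l : Fin b, C ((X ^ (a - 1 - i) * H : R[X]).coeff (b - 1 - l)) *
          X ^ (b - 1 - (l : ℕ)) = X ^ (a - 1 - i) * H := by
        rw [Fin.sum_univ_eq_sum_range
          (fun l => C ((X ^ (a - 1 - i) * H : R[X]).coeff (b - 1 - l)) * X ^ (b - 1 - l)),
          Finset.sum_range_reflect
          (fun l => C ((X ^ (a - 1 - i) * H : R[X]).coeff l) * X ^ l)]
        exact (as_sum_range_C_mul_X_pow' _ hdeg).symm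
      rw [Fin.sum_univ_add, Finset.sum_eq_single ⟨i, hi⟩]
      · have h1 : ∀ l : ℕ, a + l ≠ i := by omega
        simp only [sylRow, hi, Matrix.of_apply, Fin.val_castAdd, Fin.val_natAdd, h1, if_true,
          if_false, Nat.le_add_right, and_self, Nat.add_sub_cancel_left,
          show ∀ l : ℕ, ¬ (a + l < a) by omega, ← mul_assoc, ← Finset.sum_mul, hsum]
        ring
      · intro l _ hl
        have h1 : (l : ℕ) ≠ i := fun h => hl (Fin.ext h)
        have h2 : ¬ a ≤ (l : ℕ) := by omega
        simp [h1, h2]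
      · simp
    · rw [Finset.sum_eq_single i]
      · simp [sylRow, hi]
      · intro l _ hl
        have h1 : (l : ℕ) ≠ i := fun h => hl (Fin.ext h)
        simp [h1, hi]
      · simp

theorem rowDet_sylRow_sub_left (a N e : ℕ) (P Q : R[X]) :
    rowDet (a + a) N e (sylRow a a P (Q - P)) = rowDet (a + a) N e (sylRow a a P Q) := by
  rw [rowDet_linear (f := sylRow a a P Q) (Matrix.of fun i l : Fin (a + a) =>
    if l = i then 1 else if (l : ℕ) + a = i then -1 else 0)]
  · rw [Matrix.det_of_isLowerTriangular]
    · simp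
    · intro i l hl
      have hl' : (i : ℕ) < l := hl
      have h1 : ¬ (l = i) := by rintro rfl; exact lt_irrefl _ hl'
      have h2 : ¬ ((l : ℕ) + a = i) := by omega
      simp [h1, h2]
  · intro i
    by_cases hi : (i : ℕ) < a
    · rw [Finset.sum_eq_single i]
      · simp [sylRow, hi]
      · intro l _ hl
        have h1 : (l : ℕ) + a ≠ i := by omega
        simp [h1, hl]
      · simp
    · have hia : (i : ℕ) - a < a := by omega
      have hl0 : (⟨(i : ℕ) - a, by omega⟩ : Fin (a + a)) ≠ i := by
        intro h
        have := congrArg Fin.val h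
        simp only at this
        omega
      rw [Finset.sum_eq_add i ⟨(i : ℕ) - a, by omega⟩ hl0.symm]
      · have h1 : (i : ℕ) - a + a = i := by omega
        simp only [Matrix.of_apply, if_true, hl0, if_false, h1, sylRow, hi, hia]
        simp only [map_one, map_neg]
        ring
      · intro l _ hl
        have h1 : (l : ℕ) + a ≠ i := fun h => hl.2 (Fin.ext (by simp only; omega))
        simp [h1, hl.1]
      · simp
      · simp

theorem finRotate_pow_val (n m : ℕ) (i : Fin (n + 1)) :
    ((finRotate (n + 1) ^ m) i : ℕ) = (i + m) % (n + 1) := by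
  induction m with
  | zero => simp [Nat.mod_eq_of_lt i.2]
  | succ m ih =>
    rw [pow_succ', Equiv.Perm.mul_apply, finRotate_apply, Fin.val_add, ih]
    simp [Nat.add_mod, ← add_assoc]

theorem rowDet_sylRow_swap (m N e : ℕ) (P Q : R[X]) :
    rowDet (m + 1 + m) N e (sylRow (m + 1) m Q P) =
      rowDet (m + (m + 1)) N e (sylRow m (m + 1) P Q) := by
  have hn : m + 1 + m = 2 * m + 1 := by ring
  rw [show m + (m + 1) = 2 * m + 1 by ring, hn]
  unfold rowDet
  rw [← one_mul (Matrix.det (Matrix.of fun i c : Fin (2 * m + 1) =>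
    if (c : ℕ) < 2 * m + 1 - 1 then (sylRow m (m + 1) P Q i).coeff (N - c)
    else (sylRow m (m + 1) P Q i).coeff e))]
  have hs : ((Equiv.Perm.sign (finRotate (2 * m + 1) ^ m) : ℤ) : R) = 1 := by
    simp [sign_finRotate]
  rw [← hs, ← Matrix.det_permute]
  congr 1
  ext i c
  have hi := i.2
  have hrow : sylRow (m + 1) m Q P i =
      sylRow m (m + 1) P Q ((finRotate (2 * m + 1) ^ m) i) := by
    rw [finRotate_pow_val]
    unfold sylRow
    by_cases h : (i : ℕ) < m + 1
    · rw [Nat.mod_eq_of_lt (by omega), if_pos h, if_neg (by omega)]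
      congr 2
      omega
    · rw [Nat.mod_eq_sub_mod (by omega), Nat.mod_eq_of_lt (by omega), if_neg h, if_pos (by omega)]
      congr 2
      omega
  simp only [Matrix.of_apply, Matrix.submatrix_apply, id, hrow]

theorem sylRow_succ (a b : ℕ) (P Q : R[X]) (i : ℕ) :
    sylRow (a + 1) b P Q (i + 1) = sylRow a b P Q i := by
  simp only [sylRow, Nat.add_lt_add_iff_right, Nat.add_sub_add_right,
    show a + 1 - 1 - (i + 1) = a - 1 - i by omega]

theorem coeff_X_pow_mul_eq_zero {s t u : ℕ} {P : R[X]} (hP : P.natDegree ≤ t) (h : s + t < u) :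
    (X ^ s * P).coeff u = 0 :=
  coeff_eq_zero_of_natDegree_lt <|
    (natDegree_mul_le.trans (Nat.add_le_add (natDegree_X_pow_le _) hP)).trans_lt h

theorem rowDet_sylRow_succ {a b t u N e : ℕ} {P Q : R[X]} (hab : 1 ≤ a + b)
    (hP : P.natDegree ≤ t) (hQ : Q.natDegree ≤ u) (hN : N + 1 = a + t)
    (hu : b + u ≤ N + 1) :
    rowDet (a + b + 1) (N + 1) e (sylRow (a + 1) b P Q) =
      P.coeff t * rowDet (a + b) N e (sylRow a b P Q) := by
  rw [rowDet_succ hab]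
  · simp only [sylRow_succ]
    congr 1
    simp [sylRow, hN, coeff_X_pow_mul', add_comm a t]
  · intro i hi
    rw [sylRow_succ]
    unfold sylRow
    split_ifs
    · exact coeff_X_pow_mul_eq_zero hP (by omega)
    · exact coeff_X_pow_mul_eq_zero hQ (by omega)

end RowDet

section Subresultant

variable {R : Type*} [CommRing R]

theorem coeff_subresultant (dA dB k : ℕ) (A B : R[X]) (e : ℕ) :
    (subresultant dA dB k A B).coeff e = if e ≤ k then
      rowDet (dA + dB - 2 * k) (dA + dB - k - 1) e (sylRow (dB - k) (dA - k) A B) else 0 := by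
  unfold subresultant
  simp only [finsetSum_coeff, coeff_C_mul, coeff_X_pow, mul_ite, mul_one, mul_zero,
    Finset.sum_ite_eq, Finset.mem_range, Nat.lt_succ_iff]
  rfl

theorem natDegree_subresultant_le (dA dB k : ℕ) (A B : R[X]) :
    (subresultant dA dB k A B).natDegree ≤ k := by
  rw [natDegree_le_iff_coeff_eq_zero]
  intro e he
  rw [coeff_subresultant, if_neg (by omega)]

theorem coeff_subresultant_self (dA dB k : ℕ) (A B : R[X]) :
    (subresultant dA dB k A B).coeff k = principalSubres dA dB k A B := by
  rw [coeff_subresultant, if_pos le_rfl]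
  rfl

/-- Formula for subresultants in consecutive formal degrees. -/
theorem coeff_subresultant_consecutive (k m : ℕ) (P Q : R[X]) (e : ℕ) (he : e ≤ k) :
    (subresultant (k + m + 1) (k + m) k P Q).coeff e =
      rowDet (m + (m + 1)) (k + m + m) e (sylRow m (m + 1) P Q) := by
  rw [coeff_subresultant, if_pos he]
  congr 1 <;> first | omega | (congr 1 <;> omega)

theorem subresultant_consecutive_zero (k : ℕ) (P Q : R[X]) (hQ : Q.natDegree ≤ k) :
    subresultant (k + 1) k k P Q = Q := by
  ext e
  by_cases he : e ≤ k
  · have := coeff_subresultant_consecutive k 0 P Q e he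
    rw [add_zero] at this
    rw [this]
    simp [rowDet, sylRow]
  · rw [coeff_subresultant, if_neg he, coeff_eq_zero_of_natDegree_lt (by omega)]

theorem subresultant_consecutive_one (k : ℕ) (P Q : R[X]) (hP : P.natDegree ≤ k + 2)
    (hQ : Q.natDegree ≤ k + 1) :
    subresultant (k + 2) (k + 1) k P Q =
      C (Q.coeff (k + 1) ^ 2) * P +
        (C (-(P.coeff (k + 2) * Q.coeff (k + 1))) * X +
          C (P.coeff (k + 2) * Q.coeff k - P.coeff (k + 1) * Q.coeff (k + 1))) * Q := by
  ext e
  have hr : ∀ a b : R, ((C a * X + C b) * Q).coeff e = a * (X * Q).coeff e + b * Q.coeff e := by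
    intro a b
    rw [add_mul, mul_assoc, coeff_add, coeff_C_mul, coeff_C_mul]
  rw [coeff_add, hr, coeff_C_mul]
  by_cases he : e ≤ k
  · rw [coeff_subresultant_consecutive k 1 P Q e he]
    have hz : Q.coeff (k + 2) = 0 := coeff_eq_zero_of_natDegree_lt (by omega)
    simp [rowDet, sylRow, Matrix.det_fin_three, coeff_X_mul, hz]
    ring
  · rw [coeff_subresultant, if_neg he]
    obtain ⟨e, rfl⟩ : ∃ e', e = e' + 1 := ⟨e - 1, by omega⟩
    rw [coeff_X_mul]
    by_cases h1 : e = k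
    · subst h1; ring
    by_cases h2 : e = k + 1
    · subst h2
      rw [coeff_eq_zero_of_natDegree_lt (show Q.natDegree < k + 1 + 1 by omega)]
      ring
    rw [coeff_eq_zero_of_natDegree_lt (show Q.natDegree < e by omega),
      coeff_eq_zero_of_natDegree_lt (show Q.natDegree < e + 1 by omega),
      coeff_eq_zero_of_natDegree_lt (show P.natDegree < e + 1 by omega)]
    ring

/-- One step of the Euclidean algorithm on subresultants in consecutive formal degrees. -/
theorem subresultant_euclid (k m : ℕ) (P Q : R[X]) (hP : P.natDegree ≤ k + m + 2)
    (hQ : Q.natDegree ≤ k + m + 1) :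
    C (Q.coeff (k + m + 1) ^ (2 * (m + 1))) * subresultant (k + m + 2) (k + m + 1) k P Q =
      C (Q.coeff (k + m + 1) ^ 2) * subresultant (k + m + 1) (k + m) k Q
        (subresultant (k + m + 2) (k + m + 1) (k + m) P Q) := by
  ext e
  rw [coeff_C_mul, coeff_C_mul]
  by_cases he : e ≤ k
  · have h1 := coeff_subresultant_consecutive k (m + 1) P Q e he
    simp only [← add_assoc] at h1
    rw [show k + m + 2 = k + m + 1 + 1 from rfl, h1, coeff_subresultant_consecutive k m _ _ e he]
    set S := subresultant (k + m + 1 + 1) (k + m + 1) (k + m) P Q with hS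
    have hSd : S.natDegree ≤ k + m := natDegree_subresultant_le _ _ _ _ _
    have hSe := subresultant_consecutive_one (k + m) P Q hP hQ
    rw [show k + m + 2 = k + m + 1 + 1 from rfl, ← hS] at hSe
    set q := Q.coeff (k + m + 1) with hq
    have h2 := rowDet_sylRow_add_mul_left (a := m + 1) (b := m + 1 + 1) (k + m + 1 + m + 1) e
      (q ^ 2) P Q _ (Nat.add_comm (m + 1) 1 ▸ Nat.add_le_add_right
        (natDegree_linear_le (a := -(P.coeff (k + m + 1 + 1) * q))
          (b := P.coeff (k + m + 1 + 1) * Q.coeff (k + m) - P.coeff (k + m + 1) * q)) (m + 1))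
    rw [← hSe, ← pow_mul] at h2
    rw [show m + 1 + m + 1 + 1 = m + 1 + (m + 1 + 1) by ring, ← h2, ← rowDet_sylRow_swap,
      show m + 1 + 1 + (m + 1) = m + 1 + (m + 1) + 1 by ring,
      rowDet_sylRow_succ (t := k + m + 1) (u := k + m) (by omega) hQ hSd (by omega) (by omega),
      show m + 1 + (m + 1) = m + (m + 1) + 1 by ring,
      show k + m + 1 + m = k + m + m + 1 by ring,
      rowDet_sylRow_succ (t := k + m + 1) (u := k + m) (by omega) hQ hSd (by omega) (by omega)]
    ring
  · simp [coeff_subresultant, he]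

theorem subresultant_C_mul_right (dA dB k : ℕ) (hA : k ≤ dA) (hB : k ≤ dB) (P Q : R[X]) (c : R) :
    subresultant dA dB k P (C c * Q) = C (c ^ (dA - k)) * subresultant dA dB k P Q := by
  ext e
  rw [coeff_C_mul, coeff_subresultant, coeff_subresultant]
  split_ifs
  · rw [show dA + dB - 2 * k = dB - k + (dA - k) by omega, rowDet_sylRow_C_mul_right]
  · simp

theorem natDegree_sub_le_of_monic {n : ℕ} {A B : R[X]} (hA : A.Monic)
    (hAd : A.natDegree = n + 1) (hB : B.Monic) (hBd : B.natDegree = n + 1) :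
    (B - A).natDegree ≤ n := by
  rw [natDegree_le_iff_coeff_eq_zero]
  intro e he
  rw [coeff_sub]
  rcases Nat.lt_or_eq_of_le (Nat.succ_le_of_lt he) with h | rfl
  · rw [coeff_eq_zero_of_natDegree_lt (by omega), coeff_eq_zero_of_natDegree_lt (by omega),
      sub_zero]
  · have h1 : A.coeff (n + 1) = 1 := hAd ▸ hA
    have h2 : B.coeff (n + 1) = 1 := hBd ▸ hB
    simp [h1, h2]

theorem subresultant_monic (k m : ℕ) (A B : R[X]) (hA : A.Monic)
    (hAd : A.natDegree = k + m + 1) (hB : B.Monic) (hBd : B.natDegree = k + m + 1) :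
    subresultant (k + m + 1) (k + m) k A (B - A) =
      subresultant (k + m + 1) (k + m + 1) k A B := by
  ext e
  by_cases he : e ≤ k
  · have h1 : A.coeff (k + m + 1) = 1 := hAd ▸ hA
    rw [coeff_subresultant_consecutive k m _ _ e he, coeff_subresultant, if_pos he,
      show k + m + 1 + (k + m + 1) - 2 * k = m + 1 + (m + 1) by omega,
      show k + m + 1 + (k + m + 1) - k - 1 = k + m + m + 1 by omega,
      show k + m + 1 - k = m + 1 by omega, ← rowDet_sylRow_sub_left,
      show m + 1 + (m + 1) = m + (m + 1) + 1 by ring,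
      rowDet_sylRow_succ (t := k + m + 1) (u := k + m) (by omega) hAd.le
        (natDegree_sub_le_of_monic hA hAd hB hBd) (by omega) (by omega), h1, one_mul]
  · simp [coeff_subresultant, he]

theorem map_subresultant {S : Type*} [CommRing S] (f : R →+* S) (dA dB k : ℕ) (A B : R[X]) :
    (subresultant dA dB k A B).map f = subresultant dA dB k (A.map f) (B.map f) := by
  ext e
  rw [coeff_map, coeff_subresultant, coeff_subresultant]
  split_ifs
  · unfold rowDet
    rw [RingHom.map_det]
    congr 1
    ext i c
    simp only [RingHom.mapMatrix_apply, Matrix.map_apply, Matrix.of_apply, sylRow]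
    split_ifs <;> simp [← coeff_map]
  · simp

theorem map_principalSubres {S : Type*} [CommRing S] (f : R →+* S) (dA dB k : ℕ) (A B : R[X]) :
    f (principalSubres dA dB k A B) = principalSubres dA dB k (A.map f) (B.map f) := by
  rw [← coeff_subresultant_self, ← coeff_subresultant_self, ← map_subresultant, coeff_map]

theorem principalSubres_X_pow {d j : ℕ} (hj : j < d) :
    principalSubres d d j (X ^ d : R[X]) (X ^ d + X ^ j) = 1 := by
  rw [← coeff_subresultant_self, coeff_subresultant, if_pos le_rfl]
  unfold rowDet
  have hM : ∀ i c : Fin (d + d - 2 * j),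
      (if (c : ℕ) < d + d - 2 * j - 1 then
        (sylRow (d - j) (d - j) (X ^ d : R[X]) (X ^ d + X ^ j) i).coeff (d + d - j - 1 - c)
      else (sylRow (d - j) (d - j) (X ^ d : R[X]) (X ^ d + X ^ j) i).coeff j) =
      (sylRow (d - j) (d - j) (X ^ d : R[X]) (X ^ d + X ^ j) i).coeff (d + d - j - 1 - c) := by
    intro i c
    split_ifs with h
    · rfl
    · congr 1
      omega
  simp only [hM]
  rw [Matrix.det_of_isLowerTriangular]
  · refine Finset.prod_eq_one fun i _ => ?_
    simp only [Matrix.of_apply, sylRow]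
    split_ifs with h
    · rw [← pow_add, coeff_X_pow, if_pos (by omega)]
    · rw [mul_add, ← pow_add, ← pow_add, coeff_add, coeff_X_pow, coeff_X_pow, if_neg (by omega),
        if_pos (by omega), zero_add]
  · intro i l hl
    have hl' : (i : ℕ) < l := hl
    simp only [Matrix.of_apply, sylRow]
    split_ifs with h
    · rw [← pow_add, coeff_X_pow, if_neg (by omega)]
    · rw [mul_add, ← pow_add, ← pow_add, coeff_add, coeff_X_pow, coeff_X_pow, if_neg (by omega),
        if_neg (by omega), zero_add]

end Subresultant

section Domain

variable {R : Type*} [CommRing R] [IsDomain R]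

/-- The inductive step: descending from the pair `(P, R_{k+m+1})` to
`(R_{k+m+1}, R_{k+m})`. -/
theorem subresultant_descent {P Q T F : R[X]} {r : R} (k m : ℕ)
    (hP : P.natDegree ≤ k + m + 2) (hQ : Q.natDegree ≤ k + m + 1) (hr : r ≠ 0)
    (hq : Q.coeff (k + m + 1) ≠ 0)
    (hT : subresultant (k + m + 2) (k + m + 1) (k + m) P Q = C (r ^ 2) * T)
    (hF : subresultant (k + m + 2) (k + m + 1) k P Q = C (r ^ (2 * (m + 1))) * F) :
    subresultant (k + m + 1) (k + m) k Q T = C (Q.coeff (k + m + 1) ^ (2 * m)) * F := by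
  have h := subresultant_euclid k m P Q hP hQ
  rw [hT, hF, subresultant_C_mul_right _ _ _ (by omega) (by omega),
    show k + m + 1 - k = m + 1 by omega, ← pow_mul] at h
  have hne : C (Q.coeff (k + m + 1) ^ 2 * r ^ (2 * (m + 1))) ≠ 0 :=
    C_ne_zero.mpr (mul_ne_zero (pow_ne_zero _ hq) (pow_ne_zero _ hr))
  refine mul_left_cancel₀ hne ?_
  simp only [map_mul, map_pow] at h ⊢
  linear_combination -h

theorem subresultant_of_subresultants_of_ne_zero (d : ℕ) (A B : R[X]) (hA : A.Monic)
    (hAd : A.natDegree = d) (hB : B.Monic) (hBd : B.natDegree = d)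
    (hr : ∀ j < d, principalSubres d d j A B ≠ 0) (k m : ℕ) (hd : k + m + 1 < d) :
    subresultant (k + m + 1) (k + m) k (subresultant d d (k + m + 1) A B)
        (subresultant d d (k + m) A B) =
      C (principalSubres d d (k + m + 1) A B ^ (2 * m)) * subresultant d d k A B := by
  obtain ⟨n, hn⟩ : ∃ n, d = k + m + n + 2 := ⟨d - (k + m + 2), by omega⟩
  induction n generalizing k m with
  | zero =>
    obtain rfl : d = k + m + 2 := hn
    have htop := subresultant_monic (k + m + 1) 0 A B hA hAd hB hBd
    rw [add_zero, subresultant_consecutive_zero _ _ _ (natDegree_sub_le_of_monic hA hAd hB hBd)]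
      at htop
    rw [← coeff_subresultant_self]
    refine subresultant_descent (r := 1) k m (P := A) hAd.le
      (natDegree_subresultant_le _ _ _ _ _) one_ne_zero ?_ ?_ ?_
    · rw [coeff_subresultant_self]
      exact hr _ hd
    · rw [← htop, one_pow, map_one, one_mul]
      exact subresultant_monic (k + m) 1 A B hA hAd hB hBd
    · rw [← htop, one_pow, map_one, one_mul]
      exact subresultant_monic k (m + 1) A B hA hAd hB hBd
  | succ n ih =>
    rw [← coeff_subresultant_self]
    refine subresultant_descent (r := principalSubres d d (k + m + 2) A B) k m
      (natDegree_subresultant_le _ _ _ _ _) (natDegree_subresultant_le _ _ _ _ _)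
      (hr _ (by omega)) ?_ (ih (k + m) 1 (by omega) (by omega))
      (ih k (m + 1) (by omega) (by omega))
    rw [coeff_subresultant_self]
    exact hr _ hd

end Domain

section Generic

/-- The generic monic polynomial of degree `d` with lower coefficients `x 0, …, x (d - 1)`. -/
noncomputable def monicPoly {R : Type*} [CommRing R] (d : ℕ) (x : ℕ → R) : R[X] :=
  X ^ d + ∑ i ∈ range d, C (x i) * X ^ i

theorem map_monicPoly {R S : Type*} [CommRing R] [CommRing S] (f : R →+* S) (d : ℕ) (x : ℕ → R) :
    (monicPoly d x).map f = monicPoly d (f ∘ x) := by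
  simp [monicPoly, Polynomial.map_sum]

theorem degree_sum_range_lt {R : Type*} [CommRing R] (d : ℕ) (x : ℕ → R) :
    (∑ i ∈ range d, C (x i) * X ^ i).degree < (d : WithBot ℕ) := by
  rw [degree_lt_iff_coeff_zero]
  intro e he
  simp only [finsetSum_coeff, coeff_C_mul, coeff_X_pow]
  exact Finset.sum_eq_zero fun i hi => by
    rw [if_neg (by have := Finset.mem_range.mp hi; omega), mul_zero]

theorem monic_monicPoly {R : Type*} [CommRing R] (d : ℕ) (x : ℕ → R) : (monicPoly d x).Monic :=
  monic_X_pow_add (degree_sum_range_lt d x)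

theorem natDegree_monicPoly {R : Type*} [CommRing R] [Nontrivial R] (d : ℕ) (x : ℕ → R) :
    (monicPoly d x).natDegree = d :=
  natDegree_eq_of_degree_eq_some <| by
    rw [monicPoly, degree_add_eq_left_of_degree_lt, degree_X_pow]
    rw [degree_X_pow]
    exact degree_sum_range_lt d x

theorem eq_monicPoly {R : Type*} [CommRing R] {d : ℕ} {A : R[X]} (hA : A.Monic)
    (hAd : A.natDegree = d) : A = monicPoly d A.coeff := by
  subst hAd
  exact hA.as_sum

end Generic

end Subres

/-- For `A, B` monic of the same degree `d` over a commutative ring, for all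
`1 ≤ j ≤ d-1` and `0 ≤ k < j`, the `k`-th subresultant of `(R_j, R_{j-1})` computed in degree
`(j, j-1)` equals `r_j^(2(j-k-1)) · R_k`. -/
theorem subresultant_of_subresultants {𝔄 : Type*} [CommRing 𝔄] (d : ℕ) (A B : 𝔄[X])
    (hA : A.Monic) (hAd : A.natDegree = d) (hB : B.Monic) (hBd : B.natDegree = d)
    (j k : ℕ) (hj1 : 1 ≤ j) (hjd : j ≤ d - 1) (hk : k < j) :
    subresultant j (j - 1) k (subresultant d d j A B) (subresultant d d (j - 1) A B)
      = C (principalSubres d d j A B ^ (2 * (j - k - 1))) * subresultant d d k A B := by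
  obtain ⟨m, rfl⟩ : ∃ m, j = k + m + 1 := ⟨j - k - 1, by omega⟩
  rw [show k + m + 1 - k - 1 = m by omega, Nat.add_sub_cancel]
  let gA : (MvPolynomial (ℕ ⊕ ℕ) ℤ)[X] := Subres.monicPoly d fun i => MvPolynomial.X (Sum.inl i)
  let gB : (MvPolynomial (ℕ ⊕ ℕ) ℤ)[X] := Subres.monicPoly d fun i => MvPolynomial.X (Sum.inr i)
  have hr : ∀ j < d, principalSubres d d j gA gB ≠ 0 := by
    intro j hj h0
    let f : MvPolynomial (ℕ ⊕ ℕ) ℤ →+* ℤ := MvPolynomial.eval₂Hom (Int.castRingHom ℤ)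
      (Sum.elim (fun _ => 0) fun i => if i = j then 1 else 0)
    have hfA : gA.map f = X ^ d := by
      rw [Subres.map_monicPoly]
      simp [Subres.monicPoly, f]
    have hfB : gB.map f = X ^ d + X ^ j := by
      rw [Subres.map_monicPoly]
      simp [Subres.monicPoly, f, hj]
    have h1 := Subres.map_principalSubres f d d j gA gB
    rw [hfA, hfB, Subres.principalSubres_X_pow hj, h0, map_zero] at h1
    exact zero_ne_one h1
  have key := Subres.subresultant_of_subresultants_of_ne_zero d gA gB
    (Subres.monic_monicPoly d _) (Subres.natDegree_monicPoly d _)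
    (Subres.monic_monicPoly d _) (Subres.natDegree_monicPoly d _) hr k m (by omega)
  let f : MvPolynomial (ℕ ⊕ ℕ) ℤ →+* 𝔄 :=
    MvPolynomial.eval₂Hom (Int.castRingHom 𝔄) (Sum.elim A.coeff B.coeff)
  have hfA : gA.map f = A := by
    rw [Subres.map_monicPoly]
    refine Eq.trans ?_ (Subres.eq_monicPoly hA hAd).symm
    congr 1
    ext i
    simp [f]
  have hfB : gB.map f = B := by
    rw [Subres.map_monicPoly]
    refine Eq.trans ?_ (Subres.eq_monicPoly hB hBd).symm
    congr 1
    ext i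
    simp [f]
  simpa only [Subres.map_subresultant, Polynomial.map_mul, Polynomial.map_C, map_pow f,
    Subres.map_principalSubres f, hfA, hfB] using congrArg (Polynomial.map f) key
end

section
/- Let 𝔄 be a commutative ring, let A, B ∈ 𝔄[X] be monic of the same degree d, and for 0 ≤ j ≤ d−1 let U_j be the j-th cofactor (of A) and r_j the j-th principal subresultant of (A,B) computed in degree (d,d). Then for all 1 ≤ j ≤ d−1 and all 0 ≤ k < d−j, the k-th subresultant of the pair (U_{j−1}, U_j) computed in degree (d−j, d−j−1) equals r_j^{2(d−j−k−1)} · U_{d−1−k}. -/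
open Polynomial MeasureTheory ProbabilityTheory
open scoped ENNReal NNReal

theorem coeff_sum_C_mul_X_pow_rev {R : Type*} [CommRing R] (n : ℕ) (v : ℕ → R) (i : ℕ) :
    (∑ u ∈ Finset.range n, C (v u) * X ^ (n - 1 - u)).coeff i
      = if i < n then v (n - 1 - i) else 0 := by
  rw [← Finset.sum_range_reflect]
  have h : ∀ u ∈ Finset.range n, (C (v (n - 1 - u)) * X ^ (n - 1 - (n - 1 - u)) : R[X])
      = C (v (n - 1 - u)) * X ^ u := fun u hu => by
    rw [Finset.mem_range] at hu
    rw [show n - 1 - (n - 1 - u) = u by omega]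
  rw [Finset.sum_congr rfl h, finsetSum_coeff]
  simp [coeff_X_pow]

theorem degree_sum_C_mul_X_pow_rev_lt {R : Type*} [CommRing R] (n : ℕ) (v : ℕ → R) :
    (∑ u ∈ Finset.range n, C (v u) * X ^ (n - 1 - u) : R[X]).degree < (n : WithBot ℕ) := by
  rw [degree_lt_iff_coeff_zero]
  intro m hm
  rw [coeff_sum_C_mul_X_pow_rev, if_neg (by omega)]

theorem degree_cofactorU_lt {R : Type*} [CommRing R] (dA dB j : ℕ) (A B : R[X]) :
    (cofactorU dA dB j A B).degree < (dB - j : ℕ) :=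
  degree_sum_C_mul_X_pow_rev_lt _ _

theorem degree_cofactorV_lt {R : Type*} [CommRing R] (dA dB j : ℕ) (A B : R[X]) :
    (cofactorV dA dB j A B).degree < (dA - j : ℕ) :=
  degree_sum_C_mul_X_pow_rev_lt (dA - j) fun v => cofactorMinor dA dB j A B (dB - j + v)

/-- A combination of the rows of the truncated Sylvester matrix, written as `A * U + B * V`. -/
theorem sum_C_mul_subresRowPoly {R : Type*} [CommRing R] {dA dB j : ℕ} (hA : j ≤ dA)
    (hB : j ≤ dB) (A B : R[X]) (v : ℕ → R) :
    ∑ u ∈ Finset.range (dA + dB - 2 * j), C (v u) * subresRowPoly dA dB j A B u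
      = A * (∑ u ∈ Finset.range (dB - j), C (v u) * X ^ (dB - j - 1 - u))
        + B * (∑ u ∈ Finset.range (dA - j), C (v (dB - j + u)) * X ^ (dA - j - 1 - u)) := by
  rw [show dA + dB - 2 * j = (dB - j) + (dA - j) by omega, Finset.sum_range_add,
    Finset.mul_sum, Finset.mul_sum]
  congr 1
  · refine Finset.sum_congr rfl fun u hu => ?_
    rw [subresRowPoly, if_pos (Finset.mem_range.mp hu)]
    ring
  · refine Finset.sum_congr rfl fun u _ => ?_
    rw [subresRowPoly, if_neg (by omega), Nat.add_sub_cancel_left]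
    ring

theorem natDegree_subresRowPoly_le {R : Type*} [CommRing R] {dA dB j : ℕ} {A B : R[X]}
    (hA : A.natDegree ≤ dA) (hB : B.natDegree ≤ dB) (hjA : j ≤ dA) (hjB : j ≤ dB) {i : ℕ}
    (hi : i < dA + dB - 2 * j) :
    (subresRowPoly dA dB j A B i).natDegree ≤ dA + dB - j - 1 := by
  rw [subresRowPoly]
  split_ifs with h
  · refine natDegree_mul_le.trans ?_
    have := natDegree_X_pow_le (R := R) (dB - j - 1 - i)
    omega
  · refine natDegree_mul_le.trans ?_
    have := natDegree_X_pow_le (R := R) (dA - j - 1 - (i - (dB - j)))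
    omega

/-- Laplace expansion along the prescribed last column. -/
theorem det_subresMatrix {R : Type*} [CommRing R] {dA dB j : ℕ} (h : 2 * j < dA + dB)
    (A B : R[X]) (L : ℕ → R) :
    (subresMatrix dA dB j A B L).det
      = ∑ u ∈ Finset.range (dA + dB - 2 * j), cofactorMinor dA dB j A B u * L u := by
  let c : Fin (dA + dB - 2 * j) := ⟨dA + dB - 2 * j - 1, by omega⟩
  have key : ∀ L' : ℕ → R, (subresMatrix dA dB j A B L').det
      = (subresMatrix dA dB j A B 0).cramer (fun i => L' i) c := fun L' => by
    rw [Matrix.cramer_apply]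
    congr 1
    ext i k
    rw [Matrix.updateCol_apply]
    by_cases hk : k = c
    · rw [if_pos hk, hk]
      simp [subresMatrix, c]
    · have : (k : ℕ) < dA + dB - 2 * j - 1 := by
        have := k.2
        have : (k : ℕ) ≠ dA + dB - 2 * j - 1 := fun h => hk (Fin.ext h)
        omega
      simp [subresMatrix, hk, this]
  rw [key, LinearMap.pi_apply_eq_sum_univ, Finset.sum_apply,
    ← Fin.sum_univ_eq_sum_range (fun u => cofactorMinor dA dB j A B u * L u)]
  refine Finset.sum_congr rfl fun u _ => ?_
  rw [cofactorMinor, key, Pi.smul_apply, smul_eq_mul, mul_comm]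
  simp only [Fin.ext_iff, eq_comm]

theorem coeff_subresultant {R : Type*} [CommRing R] (dA dB j : ℕ) (A B : R[X]) {k : ℕ}
    (hk : k ≤ j) : (subresultant dA dB j A B).coeff k
      = (subresMatrix dA dB j A B fun i => (subresRowPoly dA dB j A B i).coeff k).det := by
  simp [subresultant, finsetSum_coeff, coeff_X_pow, hk]

theorem coeff_subresultant_self {R : Type*} [CommRing R] (dA dB j : ℕ) (A B : R[X]) :
    (subresultant dA dB j A B).coeff j = principalSubres dA dB j A B :=
  coeff_subresultant dA dB j A B le_rfl

theorem degree_subresultant_lt {R : Type*} [CommRing R] (dA dB j : ℕ) (A B : R[X]) :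
    (subresultant dA dB j A B).degree < (j + 1 : ℕ) := by
  rw [degree_lt_iff_coeff_zero]
  intro m hm
  rw [subresultant, finsetSum_coeff]
  refine Finset.sum_eq_zero fun i hi => ?_
  rw [coeff_C_mul, coeff_X_pow, if_neg (by rw [Finset.mem_range] at hi; omega), mul_zero]

/-- The Bézout identity satisfied by the cofactors. -/
theorem mul_cofactorU_add_mul_cofactorV {R : Type*} [CommRing R] {dA dB j : ℕ} {A B : R[X]}
    (hA : A.natDegree ≤ dA) (hB : B.natDegree ≤ dB) (hjA : j ≤ dA) (hjB : j ≤ dB)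
    (hj : 2 * j < dA + dB) :
    A * cofactorU dA dB j A B + B * cofactorV dA dB j A B = subresultant dA dB j A B := by
  rw [cofactorU, cofactorV, ← sum_C_mul_subresRowPoly hjA hjB]
  ext k
  have hsum : (∑ u ∈ Finset.range (dA + dB - 2 * j),
      C (cofactorMinor dA dB j A B u) * subresRowPoly dA dB j A B u).coeff k
      = (subresMatrix dA dB j A B fun i => (subresRowPoly dA dB j A B i).coeff k).det := by
    rw [det_subresMatrix hj, finsetSum_coeff]
    simp only [coeff_C_mul]
  rcases le_or_gt k j with hk | hk
  · rw [hsum, coeff_subresultant _ _ _ _ _ hk]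
  rw [coeff_eq_zero_of_degree_lt ((degree_subresultant_lt dA dB j A B).trans_le
    (by exact_mod_cast hk))]
  rcases le_or_gt k (dA + dB - j - 1) with hk' | hk'
  · rw [hsum]
    refine Matrix.det_zero_of_column_eq (i := ⟨dA + dB - j - 1 - k, by omega⟩)
      (j := ⟨dA + dB - 2 * j - 1, by omega⟩) (by simp only [ne_eq, Fin.mk.injEq]; omega)
      fun i => ?_
    simp only [subresMatrix, Matrix.of_apply]
    rw [if_pos (by omega), if_neg (by omega),
      show dA + dB - j - 1 - (dA + dB - j - 1 - k) = k by omega]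
  · rw [finsetSum_coeff]
    refine Finset.sum_eq_zero fun i hi => ?_
    rw [coeff_C_mul, coeff_eq_zero_of_natDegree_lt, mul_zero]
    exact (natDegree_subresRowPoly_le hA hB hjA hjB (Finset.mem_range.mp hi)).trans_lt hk'

/-- The truncated Sylvester map is injective when its determinant is nonzero. -/
theorem eq_zero_of_degree_mul_add_mul_lt {R : Type*} [CommRing R] [IsDomain R] {dA dB j : ℕ}
    {A B U V : R[X]} (hjA : j ≤ dA) (hjB : j ≤ dB) (hr : principalSubres dA dB j A B ≠ 0)
    (hU : U.degree < (dB - j : ℕ)) (hV : V.degree < (dA - j : ℕ))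
    (h : (A * U + B * V).degree < j) : U = 0 ∧ V = 0 := by
  let v : ℕ → R := fun u =>
    if u < dB - j then U.coeff (dB - j - 1 - u) else V.coeff (dA - j - 1 - (u - (dB - j)))
  have hUv : U = ∑ u ∈ Finset.range (dB - j), C (v u) * X ^ (dB - j - 1 - u) := by
    ext i
    rw [coeff_sum_C_mul_X_pow_rev]
    split_ifs with hi
    · simp only [v]
      rw [if_pos (by omega), show dB - j - 1 - (dB - j - 1 - i) = i by omega]
    · exact (degree_lt_iff_coeff_zero _ _).mp hU _ (by omega)
  have hVv : V = ∑ u ∈ Finset.range (dA - j), C (v (dB - j + u)) * X ^ (dA - j - 1 - u) := by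
    ext i
    rw [coeff_sum_C_mul_X_pow_rev (dA - j) fun u => v (dB - j + u)]
    split_ifs with hi
    · simp only [v]
      rw [if_neg (by omega), show dA - j - 1 - (dB - j + (dA - j - 1 - i) - (dB - j)) = i by omega]
    · exact (degree_lt_iff_coeff_zero _ _).mp hV _ (by omega)
  have hcoeff : ∀ m, j ≤ m → ∑ u ∈ Finset.range (dA + dB - 2 * j),
      v u * (subresRowPoly dA dB j A B u).coeff m = 0 := fun m hm => by
    have := (degree_lt_iff_coeff_zero _ _).mp h m hm
    rw [hUv, hVv, ← sum_C_mul_subresRowPoly hjA hjB, finsetSum_coeff] at this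
    simpa only [coeff_C_mul] using this
  have hv0 : (fun i : Fin (dA + dB - 2 * j) => v i) = 0 := by
    refine Matrix.eq_zero_of_vecMul_eq_zero hr ?_
    ext c
    simp only [Matrix.vecMul, dotProduct, subresMatrix, Matrix.of_apply, Pi.zero_apply]
    have hc := c.2
    split_ifs with h'
    · rw [Fin.sum_univ_eq_sum_range fun i => v i *
        (subresRowPoly dA dB j A B i).coeff (dA + dB - j - 1 - c)]
      exact hcoeff _ (by omega)
    · rw [Fin.sum_univ_eq_sum_range fun i => v i * (subresRowPoly dA dB j A B i).coeff j]
      exact hcoeff _ le_rfl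
  have hv : ∀ u < dA + dB - 2 * j, v u = 0 := fun u hu => congrFun hv0 ⟨u, hu⟩
  constructor
  · rw [hUv]
    refine Finset.sum_eq_zero fun u hu => ?_
    rw [Finset.mem_range] at hu
    rw [hv u (by omega), C_0, zero_mul]
  · rw [hVv]
    refine Finset.sum_eq_zero fun u hu => ?_
    rw [Finset.mem_range] at hu
    rw [hv _ (by omega), C_0, zero_mul]

theorem Matrix.det_of_first_last_column {R : Type*} [CommRing R] {N p : ℕ} (hp : p ≤ N)
    (f : ℕ → ℕ → R) (b : R) (hlast : ∀ i < N + 2, f i (N + 1) = if i = 0 then 1 else 0)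
    (hfirst : ∀ i < N + 1, f (i + 1) 0 = if i = p then b else 0) :
    (Matrix.of fun i c : Fin (N + 2) => f i c).det
      = (-1) ^ (N + 1 + p) * b
        * (Matrix.of fun i c : Fin N => f (if (i : ℕ) < p then i + 1 else i + 2) (c + 1)).det := by
  rw [Matrix.det_succ_column _ (Fin.last (N + 1)), Finset.sum_eq_single 0,
    Matrix.det_succ_column_zero, Finset.sum_eq_single ⟨p, by omega⟩]
  · have h0 : f 0 (N + 1) = 1 := by simpa using hlast 0 (by omega)
    have h1 : f (p + 1) 0 = b := by simpa using hfirst p (by omega)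
    simp only [Matrix.submatrix_submatrix]
    have hM : ((Matrix.of fun i c : Fin (N + 2) => f i c).submatrix
          (Fin.succAbove 0 ∘ Fin.succAbove ⟨p, by omega⟩)
          ((Fin.last (N + 1)).succAbove ∘ Fin.succ))
        = Matrix.of fun i c : Fin N => f (if (i : ℕ) < p then i + 1 else i + 2) (c + 1) := by
      ext i c
      simp only [Matrix.submatrix_apply, Matrix.of_apply, Function.comp_apply,
        Fin.zero_succAbove, Fin.succAbove_last, Fin.val_succ, Fin.val_castSucc]
      congr 1
      simp only [Fin.succAbove, Fin.lt_def, Fin.val_castSucc]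
      split_ifs <;> simp
    rw [hM]
    simp [h0, h1]
    ring
  · intro i _ hi
    have := hfirst i i.2
    rw [if_neg fun h => hi (Fin.ext h)] at this
    simp [this]
  · simp
  · intro i _ hi
    have := hlast i i.2
    rw [if_neg fun h => hi (Fin.ext (by simpa using h))] at this
    simp [this]
  · simp

/-- The top coefficient of a cofactor in terms of the next principal subresultant. -/
theorem coeff_cofactorU {R : Type*} [CommRing R] {dA dB k : ℕ} {A B : R[X]}
    (hA : A.natDegree ≤ dA) (hB : B.natDegree ≤ dB) (hkA : k + 1 ≤ dA) (hkB : k + 1 ≤ dB) :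
    (cofactorU dA dB k A B).coeff (dB - k - 1)
      = (-1) ^ (dA + k) * B.coeff dB * principalSubres dA dB (k + 1) A B := by
  rw [cofactorU, coeff_sum_C_mul_X_pow_rev, if_pos (by omega), Nat.sub_self, cofactorMinor,
    principalSubres]
  obtain ⟨N, hN⟩ : ∃ N, N = dA + dB - 2 * (k + 1) := ⟨_, rfl⟩
  have hN2 : dA + dB - 2 * k = N + 2 := by omega
  unfold subresMatrix
  rw [hN2, ← hN]
  rw [Matrix.det_of_first_last_column (p := dB - k - 1) (by omega) (fun i c => if c < N + 2 - 1 then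
    (subresRowPoly dA dB k A B i).coeff (dA + dB - k - 1 - c) else if i = 0 then 1 else 0)
    (B.coeff dB)]
  · congr 2
    · have : N + 1 + (dB - k - 1) = dA + k + 2 * (dB - k - 1 - k) ∨
        N + 1 + (dB - k - 1) + 2 * (k + k + 1 - dB) = dA + k := by omega
      rcases this with h | h
      · rw [h, pow_add, pow_mul]; simp
      · rw [← h, pow_add _ _ (2 * _), pow_mul]; simp
    · ext i c
      simp only [Matrix.of_apply]
      have hc := c.2
      have hrow : subresRowPoly dA dB k A B (if (i : ℕ) < dB - k - 1 then i + 1 else i + 2)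
          = subresRowPoly dA dB (k + 1) A B i := by
        have hi := i.2
        unfold subresRowPoly
        split_ifs <;> first | omega | (congr 2; omega)
      rw [if_pos (by omega), hrow]
      split_ifs with h
      · congr 1; omega
      · congr 1; omega
  · intro i _
    simp
  · intro i hi
    rw [if_pos (by omega)]
    unfold subresRowPoly
    rcases lt_trichotomy i (dB - k - 1) with h | h | h
    · rw [if_pos (by omega), if_neg (by omega)]
      apply coeff_eq_zero_of_natDegree_lt
      have := natDegree_mul_le (p := (X : R[X]) ^ (dB - k - 1 - (i + 1))) (q := A)
      have := natDegree_X_pow_le (R := R) (dB - k - 1 - (i + 1))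
      omega
    · rw [if_neg (by omega), if_pos h, coeff_X_pow_mul', if_pos (by omega)]
      congr 1; omega
    · rw [if_neg (by omega), if_neg (by omega)]
      apply coeff_eq_zero_of_natDegree_lt
      have := natDegree_mul_le (p := (X : R[X]) ^ (dA - k - 1 - (i + 1 - (dB - k)))) (q := B)
      have := natDegree_X_pow_le (R := R) (dA - k - 1 - (i + 1 - (dB - k)))
      omega

theorem subresultant_succ_self_self {R : Type*} [CommRing R] {m : ℕ} (A : R[X]) {B : R[X]}
    (hB : B.natDegree ≤ m) : subresultant (m + 1) m m A B = B := by
  ext k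
  rcases le_or_gt k m with hk | hk
  · rw [coeff_subresultant _ _ _ _ _ hk]
    unfold subresMatrix
    rw [show m + 1 + m - 2 * m = 1 by omega, Matrix.det_fin_one]
    simp [subresRowPoly]
  · rw [coeff_eq_zero_of_natDegree_lt (hB.trans_lt hk), coeff_eq_zero_of_degree_lt
      ((degree_subresultant_lt _ _ _ A B).trans_le (by exact_mod_cast hk))]

section Map

variable {R S : Type*} [CommRing R] [CommRing S] (φ : R →+* S) (dA dB j : ℕ) (A B : R[X])

theorem subresRowPoly_map (i : ℕ) :
    subresRowPoly dA dB j (A.map φ) (B.map φ) i = (subresRowPoly dA dB j A B i).map φ := by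
  unfold subresRowPoly
  split_ifs <;> simp

theorem det_subresMatrix_map (L : ℕ → R) :
    (subresMatrix dA dB j (A.map φ) (B.map φ) fun i => φ (L i)).det
      = φ (subresMatrix dA dB j A B L).det := by
  rw [RingHom.map_det]
  congr 1
  ext i c
  simp only [subresMatrix, subresRowPoly_map, Matrix.of_apply, coeff_map, RingHom.mapMatrix_apply,
    Matrix.map_apply, apply_ite φ]

theorem principalSubres_map :
    principalSubres dA dB j (A.map φ) (B.map φ) = φ (principalSubres dA dB j A B) := by
  simp only [principalSubres, ← det_subresMatrix_map φ, subresRowPoly_map, coeff_map]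

theorem subresultant_map :
    subresultant dA dB j (A.map φ) (B.map φ) = (subresultant dA dB j A B).map φ := by
  simp only [subresultant, Polynomial.map_sum, Polynomial.map_mul, map_C, Polynomial.map_pow,
    map_X, ← det_subresMatrix_map φ, subresRowPoly_map, coeff_map]

theorem cofactorU_map :
    cofactorU dA dB j (A.map φ) (B.map φ) = (cofactorU dA dB j A B).map φ := by
  simp only [cofactorU, cofactorMinor, Polynomial.map_sum, Polynomial.map_mul, map_C,
    Polynomial.map_pow, map_X, ← det_subresMatrix_map φ, apply_ite φ, map_one, map_zero]

end Map

theorem natDegree_le_of_degree_lt_succ {R : Type*} [CommRing R] {P : R[X]} {n : ℕ}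
    (h : P.degree < (n + 1 : ℕ)) : P.natDegree ≤ n :=
  by
  rw [natDegree_le_iff_coeff_eq_zero]
  exact fun m hm => (degree_lt_iff_coeff_zero _ _).mp h m hm

theorem degree_lt_of_degree_lt_succ_of_coeff_eq_zero {R : Type*} [CommRing R] {P : R[X]} {n : ℕ}
    (h : P.degree < (n + 1 : ℕ)) (h0 : P.coeff n = 0) : P.degree < n := by
  rw [degree_lt_iff_coeff_zero] at h ⊢
  intro m hm
  rcases hm.eq_or_lt with rfl | hm
  · exact h0
  · exact h m hm

/-- Any Bézout pair of the right degrees is proportional to the pair of cofactors. -/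
theorem C_coeff_mul_subresultant {R : Type*} [CommRing R] [IsDomain R] {k s t : ℕ}
    {A B U V : R[X]} (hA : A.natDegree ≤ k + s + 1) (hB : B.natDegree ≤ k + t + 1)
    (hlc : B.coeff (k + t + 1) ≠ 0)
    (hr : principalSubres (k + s + 1) (k + t + 1) (k + 1) A B ≠ 0)
    (hU : U.degree < (t + 1 : ℕ)) (hV : V.degree < (s + 1 : ℕ))
    (h : (A * U + B * V).degree < (k + 1 : ℕ)) :
    C (U.coeff t) * subresultant (k + s + 1) (k + t + 1) k A B
      = C ((cofactorU (k + s + 1) (k + t + 1) k A B).coeff t) * (A * U + B * V) := by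
  have hU' := degree_cofactorU_lt (k + s + 1) (k + t + 1) k A B
  have hV' := degree_cofactorV_lt (k + s + 1) (k + t + 1) k A B
  have hS := degree_subresultant_lt (k + s + 1) (k + t + 1) k A B
  have hbez := mul_cofactorU_add_mul_cofactorV (j := k) hA hB (by omega) (by omega) (by omega)
  set U' := cofactorU (k + s + 1) (k + t + 1) k A B
  set V' := cofactorV (k + s + 1) (k + t + 1) k A B
  set S := subresultant (k + s + 1) (k + t + 1) k A B
  rw [show k + t + 1 - k = t + 1 by omega] at hU'
  rw [show k + s + 1 - k = s + 1 by omega] at hV'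
  have hC : ∀ (a b : R) {P Q : R[X]} {n : ℕ}, P.degree < (n : ℕ) → Q.degree < (n : ℕ) →
      (C a * P - C b * Q).degree < (n : ℕ) := fun a b P Q n hP hQ => by
    rw [degree_lt_iff_coeff_zero] at hP hQ ⊢
    intro m hm
    simp [hP m hm, hQ m hm]
  have hcomb : A * (C (U.coeff t) * U' - C (U'.coeff t) * U)
      + B * (C (U.coeff t) * V' - C (U'.coeff t) * V)
      = C (U.coeff t) * S - C (U'.coeff t) * (A * U + B * V) := by
    rw [← hbez]; ring
  have hdeg := hC (U.coeff t) (U'.coeff t) hS h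
  have hUd := hC (U.coeff t) (U'.coeff t) hU' hU
  have hVd := hC (U.coeff t) (U'.coeff t) hV' hV
  have hUtop : (C (U.coeff t) * U' - C (U'.coeff t) * U).coeff t = 0 := by
    simp [mul_comm]
  have hVtop : (C (U.coeff t) * V' - C (U'.coeff t) * V).coeff s = 0 := by
    have h0 := (degree_lt_iff_coeff_zero _ _).mp hdeg ((k + s + 1) + t) (by omega)
    rw [← hcomb, coeff_add,
      coeff_mul_add_eq_of_natDegree_le hA (natDegree_le_of_degree_lt_succ hUd), hUtop, mul_zero,
      zero_add, show k + s + 1 + t = (k + t + 1) + s by omega,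
      coeff_mul_add_eq_of_natDegree_le hB (natDegree_le_of_degree_lt_succ hVd)] at h0
    exact (mul_eq_zero.mp h0).resolve_left hlc
  obtain ⟨hU0, hV0⟩ := eq_zero_of_degree_mul_add_mul_lt (by omega) (by omega) hr
    (U := C (U.coeff t) * U' - C (U'.coeff t) * U) (V := C (U.coeff t) * V' - C (U'.coeff t) * V)
    (by
      rw [show k + t + 1 - (k + 1) = t by omega]
      exact degree_lt_of_degree_lt_succ_of_coeff_eq_zero hUd hUtop)
    (by
      rw [show k + s + 1 - (k + 1) = s by omega]
      exact degree_lt_of_degree_lt_succ_of_coeff_eq_zero hVd hVtop)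
    (by rw [hcomb]; exact hdeg)
  rw [hU0, hV0, mul_zero, mul_zero, add_zero, eq_comm, sub_eq_zero] at hcomb
  exact hcomb

/-- The determinant `U_q V_p - V_q U_p` of two pairs of cofactors. -/
noncomputable def cofactorDet {R : Type*} [CommRing R] (d : ℕ) (A B : R[X]) (p q : ℕ) : R[X] :=
  cofactorU d d q A B * cofactorV d d p A B - cofactorV d d q A B * cofactorU d d p A B

theorem natDegree_cofactorU_le {R : Type*} [CommRing R] {dA dB j n : ℕ} (A B : R[X])
    (h : dB = j + n + 1) : (cofactorU dA dB j A B).natDegree ≤ n := by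
  have := degree_cofactorU_lt dA dB j A B
  rw [show dB - j = n + 1 by omega] at this
  exact natDegree_le_of_degree_lt_succ this

theorem natDegree_subresultant_le {R : Type*} [CommRing R] (dA dB j : ℕ) (A B : R[X]) :
    (subresultant dA dB j A B).natDegree ≤ j :=
  natDegree_le_of_degree_lt_succ (degree_subresultant_lt dA dB j A B)

theorem cofactorDet_degree_coeff {R : Type*} [CommRing R] [IsDomain R] {d : ℕ} {A B : R[X]}
    (hAd : A.natDegree = d) (hB : B.Monic) (hBd : B.natDegree = d) {p s : ℕ}
    (hd : p + 1 + s < d) :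
    (cofactorDet d A B p (p + 1 + s)).degree < (s + 1 : ℕ) ∧
    (cofactorDet d A B p (p + 1 + s)).coeff s = -(principalSubres d d (p + 1 + s) A B
      * (cofactorU d d p A B).coeff (d - p - 1)) := by
  obtain ⟨n, rfl⟩ : ∃ n, d = p + 1 + s + n + 1 := ⟨d - (p + 1 + s) - 1, by omega⟩
  set d := p + 1 + s + n + 1 with hddef
  set q := p + 1 + s with hq
  have hp := mul_cofactorU_add_mul_cofactorV (j := p) hAd.le hBd.le (by omega) (by omega) (by omega)
  have hq' := mul_cofactorU_add_mul_cofactorV (j := q) hAd.le hBd.le (by omega) (by omega)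
    (by omega)
  have hw : B * cofactorDet d A B p q = cofactorU d d q A B * subresultant d d p A B
      - subresultant d d q A B * cofactorU d d p A B := by
    rw [cofactorDet, ← hp, ← hq']; ring
  have hUp : (cofactorU d d p A B).natDegree ≤ s + n + 1 :=
    natDegree_cofactorU_le A B (by omega)
  have hUq : (cofactorU d d q A B).natDegree ≤ n := natDegree_cofactorU_le A B (by omega)
  have hRp := natDegree_subresultant_le d d p A B
  have hRq := natDegree_subresultant_le d d q A B
  have hcoeff : ∀ i, d + s ≤ i → (B * cofactorDet d A B p q).coeff i
      = -(subresultant d d q A B * cofactorU d d p A B).coeff i := fun i hi => by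
    rw [hw, coeff_sub, coeff_eq_zero_of_natDegree_lt, zero_sub]
    have := natDegree_mul_le (p := cofactorU d d q A B) (q := subresultant d d p A B)
    omega
  have hdeg : (cofactorDet d A B p q).degree < (s + 1 : ℕ) := by
    rw [degree_lt_iff_coeff_zero]
    by_contra! hcon
    obtain ⟨i, hi, hi0⟩ := hcon
    have h0 : cofactorDet d A B p q ≠ 0 := fun h => hi0 (by simp [h])
    have hi' := le_natDegree_of_ne_zero hi0
    have htop := hcoeff (B * cofactorDet d A B p q).natDegree
      (by rw [hB.natDegree_mul' h0]; omega)
    rw [coeff_natDegree, coeff_eq_zero_of_natDegree_lt (p := subresultant d d q A B * _), neg_zero,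
      leadingCoeff_eq_zero] at htop
    · exact h0 ((mul_eq_zero.mp htop).resolve_left hB.ne_zero)
    · have := natDegree_mul_le (p := subresultant d d q A B) (q := cofactorU d d p A B)
      rw [hB.natDegree_mul' h0]
      omega
  refine ⟨hdeg, ?_⟩
  have h1 := hcoeff (d + s) le_rfl
  rw [coeff_mul_add_eq_of_natDegree_le hBd.le (natDegree_le_of_degree_lt_succ hdeg)] at h1
  rw [show d + s = q + (s + n + 1) by omega, coeff_mul_add_eq_of_natDegree_le hRq hUp,
    coeff_subresultant_self] at h1
  rw [show d - p - 1 = s + n + 1 by omega, ← h1, ← hBd, hB.coeff_natDegree, one_mul]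

theorem subresultant_of_cofactors_of_ne_zero {R : Type*} [CommRing R] [IsDomain R] {d : ℕ}
    {A B : R[X]} (hAd : A.natDegree = d) (hB : B.Monic) (hBd : B.natDegree = d)
    (hr : ∀ i, 1 ≤ i → i < d → principalSubres d d i A B ≠ 0) (p s k : ℕ)
    (hd : d = p + k + s + 2) :
    subresultant (k + s + 1) (k + s) k (cofactorU d d p A B) (cofactorU d d (p + 1) A B)
      = C (principalSubres d d (p + 1) A B ^ (2 * s)) * cofactorU d d (p + 1 + s) A B := by
  have hlc : ∀ i n, d = i + n + 1 → (cofactorU d d i A B).coeff n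
      = (-1) ^ (d + i) * principalSubres d d (i + 1) A B := fun i n hi => by
    have := coeff_cofactorU (k := i) hAd.le hBd.le (by omega) (by omega)
    rwa [show d - i - 1 = n by omega, ← hBd, hB.coeff_natDegree, mul_one, hBd] at this
  induction s generalizing k with
  | zero =>
    simpa using subresultant_succ_self_self (m := k) (cofactorU d d p A B)
      (natDegree_cofactorU_le A B (by omega) : (cofactorU d d (p + 1) A B).natDegree ≤ k)
  | succ s ih =>
    have ih' := ih (k + 1) (by omega)
    rw [show k + 1 + s = k + s + 1 by omega] at ih'
    have hnd0 : (cofactorU d d p A B).natDegree ≤ k + (s + 1) + 1 :=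
      natDegree_cofactorU_le A B (by omega)
    have hnd1 : (cofactorU d d (p + 1) A B).natDegree ≤ k + s + 1 :=
      natDegree_cofactorU_le A B (by omega)
    have hlc0 := hlc p (k + s + 2) (by omega)
    have hlc1 := hlc (p + 1) (k + s + 1) (by omega)
    have hlc2 := hlc (p + 1 + s) (k + 1) (by omega)
    have hr' : principalSubres (k + s + 2) (k + s + 1) (k + 1) (cofactorU d d p A B)
        (cofactorU d d (p + 1) A B) = principalSubres d d (p + 1) A B ^ (2 * s)
          * ((-1) ^ (d + (p + 1 + s)) * principalSubres d d (p + 1 + s + 1) A B) := by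
      rw [← coeff_subresultant_self, ih', coeff_C_mul, hlc2]
    have hne1 := hr (p + 1) (by omega) (by omega)
    have hne2 := hr (p + 2) (by omega) (by omega)
    have hne3 := hr (p + 1 + s + 1) (by omega) (by omega)
    have hsign : ∀ n : ℕ, (-1 : R) ^ n ≠ 0 := fun n =>
      pow_ne_zero _ (neg_ne_zero.mpr one_ne_zero)
    obtain ⟨hα, hαc⟩ := cofactorDet_degree_coeff hAd hB hBd (p := p + 1) (s := s) (by omega)
    obtain ⟨hβ, -⟩ := cofactorDet_degree_coeff hAd hB hBd (p := p) (s := s + 1) (by omega)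
    obtain ⟨hδ, hδc⟩ := cofactorDet_degree_coeff hAd hB hBd (p := p) (s := 0) (by omega)
    rw [show p + 1 + 1 + s = p + 1 + (s + 1) by omega] at hα hαc
    rw [show d - (p + 1) - 1 = k + s + 1 by omega, hlc1] at hαc
    rw [show d - p - 1 = k + s + 2 by omega, hlc0, add_zero] at hδc
    rw [add_zero] at hδ
    have hδC := eq_C_of_natDegree_le_zero (natDegree_le_of_degree_lt_succ hδ)
    rw [hδc] at hδC
    have hrel : cofactorU d d p A B * cofactorDet d A B (p + 1) (p + 1 + (s + 1))
        + cofactorU d d (p + 1) A B * (-cofactorDet d A B p (p + 1 + (s + 1)))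
        = C (principalSubres d d (p + 1) A B * ((-1) ^ (d + p) * principalSubres d d (p + 1) A B))
          * cofactorU d d (p + 1 + (s + 1)) A B := by
      rw [← neg_neg (C _), ← C_neg, ← hδC]
      simp only [cofactorDet]
      ring
    have hkey := C_coeff_mul_subresultant (k := k) (s := s + 1) (t := s) hnd0 hnd1
      (by rw [hlc1]; exact mul_ne_zero (hsign _) hne2)
      (by
        rw [show k + (s + 1) + 1 = k + s + 2 by omega, hr']
        exact mul_ne_zero (pow_ne_zero _ hne1) (mul_ne_zero (hsign _) hne3))
      hα (by rw [degree_neg]; exact hβ)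
      (by
        rw [hrel]
        have := degree_cofactorU_lt d d (p + 1 + (s + 1)) A B
        rw [show d - (p + 1 + (s + 1)) = k + 1 by omega] at this
        rw [degree_lt_iff_coeff_zero] at this ⊢
        intro m hm
        rw [coeff_C_mul, this m hm, mul_zero])
    have hu := coeff_cofactorU (k := k) hnd0 hnd1 (by omega) (by omega)
    rw [show k + s + 1 - k - 1 = s by omega, hlc1, show k + (s + 1) + 1 = k + s + 2 by omega,
      hr'] at hu
    rw [hrel, hαc, show k + (s + 1) + 1 = k + s + 2 by omega, hu] at hkey
    rw [show k + (s + 1) + 1 = k + s + 2 by omega, show k + (s + 1) = k + s + 1 by omega]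
    refine mul_left_cancel₀ (C_ne_zero.mpr (neg_ne_zero.mpr (mul_ne_zero hne3
      (mul_ne_zero (hsign _) hne2)))) (hkey.trans ?_)
    rw [← mul_assoc (C _) (C _), ← mul_assoc (C _) (C _), ← C_mul, ← C_mul]
    congr 2
    have hs : (-1 : R) ^ (k + s + 2 + k) * (-1) ^ (d + (p + 1 + s)) * (-1) ^ (d + p) = -1 := by
      rw [← pow_add, ← pow_add]
      exact Odd.neg_one_pow ⟨d + p + k + s + 1, by omega⟩
    linear_combination (-1) ^ (d + (p + 1)) * principalSubres d d (p + 1 + 1) A B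
      * principalSubres d d (p + 1) A B ^ (2 * s) * principalSubres d d (p + 1 + s + 1) A B
      * principalSubres d d (p + 1) A B ^ 2 * hs

theorem principalSubres_ne_zero {R : Type*} [CommRing R] [IsDomain R] {dA dB j : ℕ} {A B : R[X]}
    (hA : A.natDegree ≤ dA) (hB : B.natDegree ≤ dB) (hjA : j ≤ dA) (hjB : j ≤ dB)
    (h : ∀ U V : R[X], U.degree < (dB - j : ℕ) → V.degree < (dA - j : ℕ) →
      (A * U + B * V).degree < j → U = 0 ∧ V = 0) : principalSubres dA dB j A B ≠ 0 := by
  intro hdet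
  obtain ⟨v, hv0, hv⟩ := Matrix.exists_vecMul_eq_zero_iff.mpr hdet
  let w : ℕ → R := fun u => if hu : u < dA + dB - 2 * j then v ⟨u, hu⟩ else 0
  have hvw : ∀ u : Fin (dA + dB - 2 * j), v u = w u := fun u => by simp [w]
  obtain ⟨hU, hV⟩ := h _ _ (degree_sum_C_mul_X_pow_rev_lt (dB - j) w)
    (degree_sum_C_mul_X_pow_rev_lt (dA - j) fun u => w (dB - j + u)) (by
      rw [← sum_C_mul_subresRowPoly hjA hjB, degree_lt_iff_coeff_zero]
      intro m hm
      rw [finsetSum_coeff]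
      simp only [coeff_C_mul]
      rcases le_or_gt m (dA + dB - j - 1) with hm' | hm'
      · rcases Nat.eq_zero_or_pos (dA + dB - 2 * j) with hn | hn
        · rw [hn, Finset.sum_range_zero]
        have hc := congrFun hv ⟨dA + dB - j - 1 - m, by omega⟩
        simp only [Matrix.vecMul, dotProduct, subresMatrix, Matrix.of_apply, Pi.zero_apply,
          hvw] at hc
        rw [← Fin.sum_univ_eq_sum_range fun u => w u * (subresRowPoly dA dB j A B u).coeff m, ← hc]
        refine Finset.sum_congr rfl fun u _ => ?_
        split_ifs with h'
        · rw [show dA + dB - j - 1 - (dA + dB - j - 1 - m) = m by omega]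
        · rw [show m = j by omega]
      · refine Finset.sum_eq_zero fun u hu => ?_
        rw [coeff_eq_zero_of_natDegree_lt, mul_zero]
        exact (natDegree_subresRowPoly_le hA hB hjA hjB (Finset.mem_range.mp hu)).trans_lt hm')
  refine hv0 (funext fun u => ?_)
  have hu := u.2
  rw [hvw, Pi.zero_apply]
  rcases lt_or_ge (u : ℕ) (dB - j) with h' | h'
  · have := coeff_sum_C_mul_X_pow_rev (dB - j) w (dB - j - 1 - u)
    rw [hU, coeff_zero, if_pos (by omega),
      show dB - j - 1 - (dB - j - 1 - (u : ℕ)) = u by omega] at this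
    exact this.symm
  · have := coeff_sum_C_mul_X_pow_rev (dA - j) (fun u => w (dB - j + u))
      (dA - j - 1 - (u - (dB - j)))
    rw [hV, coeff_zero, if_pos (by omega),
      show dB - j + (dA - j - 1 - (dA - j - 1 - ((u : ℕ) - (dB - j)))) = u by omega] at this
    exact this.symm

/-- Adding its derivative to a polynomial with simple rational roots gives a pair whose principal
subresultants are all nonzero. -/
theorem principalSubres_nodal_ne_zero {d j : ℕ} (hj : j < d) :
    principalSubres d d j (Lagrange.nodal (Finset.range d) (Nat.cast : ℕ → ℚ)
        + derivative (Lagrange.nodal (Finset.range d) (Nat.cast : ℕ → ℚ)))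
      (Lagrange.nodal (Finset.range d) (Nat.cast : ℕ → ℚ)) ≠ 0 := by
  set B : ℚ[X] := Lagrange.nodal (Finset.range d) (Nat.cast : ℕ → ℚ) with hBdef
  have hBd : B.natDegree = d := by simp [hBdef]
  have hB : B.Monic := Lagrange.nodal_monic
  have hinj : Set.InjOn (Nat.cast : ℕ → ℚ) (Finset.range d) := Nat.cast_injective.injOn
  refine principalSubres_ne_zero (natDegree_add_le_of_degree_le hBd.le
    ((natDegree_derivative_le B).trans (by omega))) hBd.le hj.le hj.le fun U V hU hV hT => ?_
  set T := (B + derivative B) * U + B * V with hTdef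
  have hUT : (U * T).degree < (d - 1 : ℕ) := by
    rcases eq_or_ne U 0 with rfl | hU0
    · simp
    rcases eq_or_ne T 0 with hT0 | hT0
    · simp [hT0]
    rw [← natDegree_lt_iff_degree_lt hU0] at hU
    rw [← natDegree_lt_iff_degree_lt hT0] at hT
    rw [← natDegree_lt_iff_degree_lt (mul_ne_zero hU0 hT0), natDegree_mul hU0 hT0]
    omega
  have hsum := Lagrange.coeff_eq_sum (s := Finset.range d) hinj (P := U * T)
    (hUT.trans_le (by rw [Finset.card_range]; exact_mod_cast Nat.sub_le d 1))
  rw [Finset.card_range, coeff_eq_zero_of_degree_lt hUT] at hsum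
  have hsq : ∀ i ∈ Finset.range d, (U * T).eval (i : ℚ)
      / ∏ l ∈ (Finset.range d).erase i, ((i : ℚ) - l) = U.eval (i : ℚ) ^ 2 := fun i hi => by
    have hB0 : B.eval (i : ℚ) = 0 := Lagrange.eval_nodal_at_node hi
    have hB1 : (derivative B).eval (i : ℚ) = ∏ l ∈ (Finset.range d).erase i, ((i : ℚ) - l) := by
      rw [hBdef, Lagrange.eval_nodal_derivative_eval_node_eq hi, Lagrange.eval_nodal]
    have hne : ∏ l ∈ (Finset.range d).erase i, ((i : ℚ) - l) ≠ 0 :=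
      Finset.prod_ne_zero_iff.mpr fun l hl =>
        sub_ne_zero.mpr (Nat.cast_injective.ne (Finset.ne_of_mem_erase hl).symm)
    rw [div_eq_iff hne, ← hB1, hTdef]
    simp [hB0]
    ring
  rw [Finset.sum_congr rfl hsq, eq_comm, Finset.sum_eq_zero_iff_of_nonneg
    fun i _ => sq_nonneg _] at hsum
  have hU0 : U = 0 := eq_zero_of_degree_lt_of_eval_index_eq_zero (s := Finset.range d) hinj
    (hU.trans_le (by rw [Finset.card_range]; exact_mod_cast Nat.sub_le d j))
    fun i hi => pow_eq_zero_iff two_ne_zero |>.mp (hsum i hi)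
  refine ⟨hU0, ?_⟩
  by_contra hV0
  rw [hTdef, hU0, mul_zero, zero_add,
    ← natDegree_lt_iff_degree_lt (mul_ne_zero hB.ne_zero hV0), natDegree_mul hB.ne_zero hV0] at hT
  omega

/-- The monic polynomial of degree `d` with lower coefficients given by `v`. -/
noncomputable def monicOfCoeffs {R : Type*} [CommRing R] (d : ℕ) (v : ℕ → R) : R[X] :=
  X ^ d + ∑ i ∈ Finset.range d, C (v i) * X ^ i

theorem degree_sum_C_mul_X_pow_lt {R : Type*} [CommRing R] (d : ℕ) (v : ℕ → R) :
    (∑ i ∈ Finset.range d, C (v i) * X ^ i : R[X]).degree < (d : WithBot ℕ) := by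
  rw [degree_lt_iff_coeff_zero]
  intro m hm
  simp [finsetSum_coeff, coeff_X_pow, hm.not_gt]

theorem monicOfCoeffs_monic {R : Type*} [CommRing R] (d : ℕ) (v : ℕ → R) :
    (monicOfCoeffs d v).Monic :=
  monic_X_pow_add (degree_sum_C_mul_X_pow_lt d v)

theorem natDegree_monicOfCoeffs {R : Type*} [CommRing R] [Nontrivial R] (d : ℕ) (v : ℕ → R) :
    (monicOfCoeffs d v).natDegree = d := by
  rw [monicOfCoeffs, natDegree_add_eq_left_of_degree_lt, natDegree_X_pow]
  rw [degree_X_pow]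
  exact degree_sum_C_mul_X_pow_lt d v

theorem monicOfCoeffs_map {R S : Type*} [CommRing R] [CommRing S] (φ : R →+* S) (d : ℕ)
    (v : ℕ → R) : (monicOfCoeffs d v).map φ = monicOfCoeffs d fun i => φ (v i) := by
  simp [monicOfCoeffs, Polynomial.map_sum]

theorem Polynomial.Monic.eq_monicOfCoeffs {R : Type*} [CommRing R] {P : R[X]} (hP : P.Monic) :
    P = monicOfCoeffs P.natDegree P.coeff :=
  hP.as_sum

/-- The specialization of the generic coefficients `X (inl i)`, `X (inr i)` to those of `A`
and `B`. -/
noncomputable def specializeCoeffs {R : Type*} [CommRing R] (A B : R[X]) :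
    MvPolynomial (ℕ ⊕ ℕ) ℤ →+* R :=
  MvPolynomial.eval₂Hom (Int.castRingHom R) (Sum.elim A.coeff B.coeff)

theorem monicOfCoeffs_inl_map {R : Type*} [CommRing R] {d : ℕ} {A : R[X]} (hA : A.Monic)
    (hAd : A.natDegree = d) (B : R[X]) :
    (monicOfCoeffs d fun i => MvPolynomial.X (R := ℤ) (Sum.inl i)).map (specializeCoeffs A B)
      = A := by
  rw [monicOfCoeffs_map]
  simp only [specializeCoeffs, MvPolynomial.coe_eval₂Hom, MvPolynomial.eval₂_X, Sum.elim_inl]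
  rw [← hAd]
  exact hA.eq_monicOfCoeffs.symm

theorem monicOfCoeffs_inr_map {R : Type*} [CommRing R] {d : ℕ} {B : R[X]} (hB : B.Monic)
    (hBd : B.natDegree = d) (A : R[X]) :
    (monicOfCoeffs d fun i => MvPolynomial.X (R := ℤ) (Sum.inr i)).map (specializeCoeffs A B)
      = B := by
  rw [monicOfCoeffs_map]
  simp only [specializeCoeffs, MvPolynomial.coe_eval₂Hom, MvPolynomial.eval₂_X, Sum.elim_inr]
  rw [← hBd]
  exact hB.eq_monicOfCoeffs.symm

theorem principalSubres_generic_ne_zero {d j : ℕ} (hj : j < d) :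
    principalSubres d d j (monicOfCoeffs d fun i => MvPolynomial.X (R := ℤ) (Sum.inl i : ℕ ⊕ ℕ))
      (monicOfCoeffs d fun i => MvPolynomial.X (R := ℤ) (Sum.inr i : ℕ ⊕ ℕ)) ≠ 0 := by
  intro h
  refine principalSubres_nodal_ne_zero hj ?_
  set B : ℚ[X] := Lagrange.nodal (Finset.range d) (Nat.cast : ℕ → ℚ) with hBdef
  have hBd : B.natDegree = d := by simp [hBdef]
  have hB : B.Monic := Lagrange.nodal_monic
  have hdeg : (derivative B).degree < B.degree := degree_derivative_lt hB.ne_zero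
  have hA : (B + derivative B).Monic := hB.add_of_left hdeg
  have hAd : (B + derivative B).natDegree = d := by
    rw [natDegree_add_eq_left_of_degree_lt hdeg, hBd]
  have := principalSubres_map (specializeCoeffs (B + derivative B) B) d d j
    (monicOfCoeffs d fun i => MvPolynomial.X (Sum.inl i))
    (monicOfCoeffs d fun i => MvPolynomial.X (Sum.inr i))
  rwa [monicOfCoeffs_inl_map hA hAd, monicOfCoeffs_inr_map hB hBd, h, map_zero] at this

/-- For `A, B` monic of the same degree `d` over a commutative ring, for all
`1 ≤ j ≤ d-1` and `0 ≤ k < d-j`, the `k`-th subresultant of `(U_{j-1}, U_j)` computed in degree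
`(d-j, d-j-1)` equals `r_j^(2(d-j-k-1)) · U_{d-1-k}`. -/
theorem subresultant_of_cofactors {𝔄 : Type*} [CommRing 𝔄] (d : ℕ) (A B : 𝔄[X])
    (hA : A.Monic) (hAd : A.natDegree = d) (hB : B.Monic) (hBd : B.natDegree = d)
    (j k : ℕ) (hj1 : 1 ≤ j) (hjd : j ≤ d - 1) (hk : k < d - j) :
    subresultant (d - j) (d - j - 1) k (cofactorU d d (j - 1) A B) (cofactorU d d j A B)
      = C (principalSubres d d j A B ^ (2 * (d - j - k - 1))) * cofactorU d d (d - 1 - k) A B := by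
  obtain ⟨p, rfl⟩ : ∃ p, j = p + 1 := ⟨j - 1, by omega⟩
  obtain ⟨s, rfl⟩ : ∃ s, d = p + k + s + 2 := ⟨d - (p + k + 2), by omega⟩
  have hgen := subresultant_of_cofactors_of_ne_zero
    (natDegree_monicOfCoeffs _ fun i => MvPolynomial.X (R := ℤ) (Sum.inl i : ℕ ⊕ ℕ))
    (monicOfCoeffs_monic _ _)
    (natDegree_monicOfCoeffs _ fun i => MvPolynomial.X (R := ℤ) (Sum.inr i : ℕ ⊕ ℕ))
    (fun i _ hi => principalSubres_generic_ne_zero hi) p s k rfl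
  have h := congrArg (Polynomial.map (specializeCoeffs A B)) hgen
  rw [← subresultant_map, ← cofactorU_map, ← cofactorU_map, Polynomial.map_mul, map_C, map_pow,
    ← principalSubres_map, ← cofactorU_map, monicOfCoeffs_inl_map hA hAd,
    monicOfCoeffs_inr_map hB hBd] at h
  rw [show p + k + s + 2 - (p + 1) = k + s + 1 by omega, Nat.add_sub_cancel, Nat.add_sub_cancel,
    show k + s + 1 - k - 1 = s by omega, show p + k + s + 2 - 1 - k = p + 1 + s by omega]
  exact h
end

section
/- Let a, b > 1 be real numbers and let X and X' be independent ℕ-valued random variables with geometric distributions of parameters (1 − a^{−1}) and (1 − b^{−1}) respectively, i.e. P[X = k] = (1 − a^{−1})·a^{−k} and P[X' = k] = (1 − b^{−1})·b^{−k} for k ∈ ℕ. Then Cov(X, min(X, X')) = ab/(ab − 1)². -/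
open Polynomial MeasureTheory ProbabilityTheory
open scoped ENNReal NNReal


/-- A set whose outer measure and that of its complement add up to at most the (finite) total mass
is null-measurable. -/
lemma nullMeasurableSet_of_measure_add_measure_compl_le {α : Type*} [MeasurableSpace α]
    {μ : Measure α} [IsFiniteMeasure μ] {s : Set α} (h : μ s + μ sᶜ ≤ μ Set.univ) :
    NullMeasurableSet s μ := by
  have hcover : toMeasurable μ s ∪ toMeasurable μ sᶜ = Set.univ :=
    Set.eq_univ_of_univ_subset <| (Set.union_compl_self s).symm.subset.trans <|
      Set.union_subset_union (subset_toMeasurable μ s) (subset_toMeasurable μ sᶜ)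
  have hadd := measure_union_add_inter (μ := μ) (toMeasurable μ s)
    (measurableSet_toMeasurable μ sᶜ)
  rw [hcover, measure_toMeasurable, measure_toMeasurable] at hadd
  have hinter : μ (toMeasurable μ s ∩ toMeasurable μ sᶜ) = 0 := by
    rw [← hadd] at h
    have hle : μ Set.univ + μ (toMeasurable μ s ∩ toMeasurable μ sᶜ) ≤ μ Set.univ + 0 := by
      rw [hadd, add_zero, ← hadd]
      exact h
    exact le_antisymm ((ENNReal.add_le_add_iff_left (measure_ne_top μ _)).1 hle) zero_le
  have hdiff : μ (toMeasurable μ s \ s) = 0 :=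
    measure_mono_null
      (Set.inter_subset_inter_right (toMeasurable μ s) (subset_toMeasurable μ sᶜ)) hinter
  have hs : s = toMeasurable μ s \ (toMeasurable μ s \ s) := by
    rw [Set.sdiff_sdiff_cancel_left (subset_toMeasurable μ s)]
  rw [hs]
  exact (measurableSet_toMeasurable μ s).nullMeasurableSet.diff (NullMeasurableSet.of_null hdiff)

/-- A map to a countable type whose fibres have outer measures adding up to at most the (finite)
total mass is a.e.-measurable. -/
lemma aemeasurable_of_tsum_measure_fiber_le {α ι : Type*} [MeasurableSpace α] [Countable ι]
    [MeasurableSpace ι] [MeasurableSpace.CountablyGenerated ι] {μ : Measure α} [IsFiniteMeasure μ]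
    {f : α → ι} (h : ∑' i, μ (f ⁻¹' {i}) ≤ μ Set.univ) :
    AEMeasurable f μ := by
  have hfiber (t : Set ι) : μ (f ⁻¹' t) ≤ ∑' i : t, μ (f ⁻¹' {(i : ι)}) := by
    refine (measure_mono fun x hx ↦ ?_).trans
      (measure_iUnion_le (fun i : t ↦ f ⁻¹' {(i : ι)}))
    exact Set.mem_iUnion.2 ⟨⟨f x, hx⟩, rfl⟩
  have hnull : NullMeasurable f μ := fun t _ ↦ by
    refine nullMeasurableSet_of_measure_add_measure_compl_le (le_trans ?_ h)
    rw [← ENNReal.summable.tsum_add_tsum_compl (s := t) ENNReal.summable]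
    exact add_le_add (hfiber t) (hfiber tᶜ)
  exact hnull.aemeasurable

/-- A variable with geometric point probabilities is a.e.-measurable with geometric law. -/
lemma hasLaw_geometricMeasure_of_measure_fiber {Ω : Type*} [MeasurableSpace Ω] {μ : Measure Ω}
    [IsProbabilityMeasure μ] {p : unitInterval} (hp : p ≠ 0) {X : Ω → ℕ}
    (hX : ∀ k : ℕ, μ (X ⁻¹' {k}) = ENNReal.ofReal ((1 - p) ^ k * p)) :
    HasLaw X (geometricMeasure p) μ := by
  have hmeas : AEMeasurable X μ := by
    apply aemeasurable_of_tsum_measure_fiber_le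
    simp_rw [hX]
    rw [← ENNReal.ofReal_tsum_of_nonneg (geometricMeasure_nonneg p)
      (hasSum_one_geometricMeasure hp).summable, (hasSum_one_geometricMeasure hp).tsum_eq]
    simp
  refine ⟨hmeas, Measure.ext_of_singleton fun k ↦ ?_⟩
  rw [Measure.map_apply_of_aemeasurable hmeas (measurableSet_singleton k), hX,
    geometricMeasure_singleton hp]

section geometricMeasure

variable {p : unitInterval}

lemma norm_one_sub_lt_one (hp : p ≠ 0) : ‖(1 - p : ℝ)‖ < 1 := by
  have hp0 : (0 : ℝ) < p := unitInterval.pos_iff_ne_zero.2 hp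
  rw [Real.norm_of_nonneg (by linarith [p.2.2])]
  linarith

lemma integrable_natCast_geometricMeasure (hp : p ≠ 0) :
    Integrable (fun n : ℕ ↦ (n : ℝ)) (geometricMeasure p) := by
  rw [integrable_geometricMeasure_iff hp]
  refine ((hasSum_coe_mul_geometric_of_norm_lt_one
    (norm_one_sub_lt_one hp)).summable.mul_right (p : ℝ)).congr fun n ↦ ?_
  rw [Real.norm_natCast]
  ring

lemma integral_natCast_mul_pow_geometricMeasure (hp : p ≠ 0) {s : ℝ} (hs : ‖s‖ ≤ 1) :
    ∫ n : ℕ, (n : ℝ) * s ^ n ∂geometricMeasure p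
      = p * ((1 - p) * s / (1 - (1 - p) * s) ^ 2) := by
  have hlt : ‖(1 - p : ℝ) * s‖ < 1 := by
    rw [norm_mul]
    exact mul_lt_one_of_nonneg_of_lt_one_left (norm_nonneg _) (norm_one_sub_lt_one hp) hs
  rw [integral_geometricMeasure hp, ← tsum_coe_mul_geometric_of_norm_lt_one hlt, ← tsum_mul_left]
  refine tsum_congr fun n ↦ ?_
  rw [smul_eq_mul, mul_pow]
  ring

lemma integral_pow_geometricMeasure (hp : p ≠ 0) {s : ℝ} (hs : ‖s‖ ≤ 1) :
    ∫ n : ℕ, s ^ n ∂geometricMeasure p = p * (1 - (1 - p) * s)⁻¹ := by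
  have hlt : ‖(1 - p : ℝ) * s‖ < 1 := by
    rw [norm_mul]
    exact mul_lt_one_of_nonneg_of_lt_one_left (norm_nonneg _) (norm_one_sub_lt_one hp) hs
  rw [integral_geometricMeasure hp, ← tsum_geometric_of_norm_lt_one hlt, ← tsum_mul_left]
  refine tsum_congr fun n ↦ ?_
  rw [smul_eq_mul, mul_pow]
  ring

lemma integral_natCast_geometricMeasure (hp : p ≠ 0) :
    ∫ n : ℕ, (n : ℝ) ∂geometricMeasure p = (1 - p) / p := by
  have hp0 : (p : ℝ) ≠ 0 := unitInterval.coe_ne_zero.2 hp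
  have h := integral_natCast_mul_pow_geometricMeasure hp (s := 1) (by simp)
  simp only [one_pow, mul_one, sub_sub_cancel] at h
  rw [h]
  field_simp

lemma integral_min_geometricMeasure (hp : p ≠ 0) (i : ℕ) :
    ∫ n : ℕ, ((min i n : ℕ) : ℝ) ∂geometricMeasure p = (1 - p) * (1 - (1 - p) ^ i) / p := by
  have hp0 : (p : ℝ) ≠ 0 := unitInterval.coe_ne_zero.2 hp
  rw [integral_geometricMeasure hp]
  refine HasSum.tsum_eq ?_
  induction i with
  | zero => simp
  | succ i ih =>
    rw [← hasSum_nat_add_iff' 1]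
    convert! ((hasSum_one_geometricMeasure hp).add ih).mul_left (1 - p : ℝ) using 1
    · ext n
      rw [Nat.add_min_add_right]
      push_cast
      simp only [smul_eq_mul]
      ring
    · simp only [Finset.range_one, Finset.sum_singleton, Nat.min_zero, Nat.cast_zero, smul_zero,
        sub_zero]
      field_simp
      ring

lemma integrable_min_geometricMeasure_prod {r : unitInterval} (hp : p ≠ 0) :
    Integrable (fun z : ℕ × ℕ ↦ ((min z.1 z.2 : ℕ) : ℝ))
      ((geometricMeasure p).prod (geometricMeasure r)) := by
  refine ((integrable_natCast_geometricMeasure hp).comp_fst _).mono'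
    (by fun_prop) (ae_of_all _ fun z ↦ ?_)
  rw [Real.norm_natCast]
  exact_mod_cast min_le_left _ _

lemma integrable_mul_min_geometricMeasure_prod {r : unitInterval} (hp : p ≠ 0) (hr : r ≠ 0) :
    Integrable (fun z : ℕ × ℕ ↦ (z.1 : ℝ) * ((min z.1 z.2 : ℕ) : ℝ))
      ((geometricMeasure p).prod (geometricMeasure r)) := by
  refine ((integrable_natCast_geometricMeasure hp).mul_prod
    (integrable_natCast_geometricMeasure hr)).mono' (by fun_prop) (ae_of_all _ fun z ↦ ?_)
  rw [norm_mul, Real.norm_natCast, Real.norm_natCast]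
  gcongr
  exact min_le_right _ _

lemma integral_min_geometricMeasure_prod {r : unitInterval} (hp : p ≠ 0) (hr : r ≠ 0) :
    ∫ z : ℕ × ℕ, ((min z.1 z.2 : ℕ) : ℝ) ∂(geometricMeasure p).prod (geometricMeasure r)
      = (1 - r) / r * (1 - p * (1 - (1 - p) * (1 - r : ℝ))⁻¹) := by
  have hs := (norm_one_sub_lt_one hr).le
  have hpow : Integrable (fun n : ℕ ↦ (1 - r : ℝ) ^ n) (geometricMeasure p) := by
    refine (integrable_const (1 : ℝ)).mono' (by fun_prop) (ae_of_all _ fun n ↦ ?_)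
    rw [norm_pow]
    exact pow_le_one₀ (norm_nonneg _) hs
  rw [integral_prod _ (integrable_min_geometricMeasure_prod hp)]
  simp_rw [integral_min_geometricMeasure hr, mul_div_right_comm]
  rw [integral_const_mul, integral_sub (integrable_const _) hpow,
    integral_pow_geometricMeasure hp hs]
  simp

lemma integral_mul_min_geometricMeasure_prod {r : unitInterval} (hp : p ≠ 0) (hr : r ≠ 0) :
    ∫ z : ℕ × ℕ, (z.1 : ℝ) * ((min z.1 z.2 : ℕ) : ℝ)
        ∂(geometricMeasure p).prod (geometricMeasure r)
      = (1 - r) / r *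
        ((1 - p) / p - p * ((1 - p) * (1 - r) / (1 - (1 - p) * (1 - r)) ^ 2)) := by
  have hs := (norm_one_sub_lt_one hr).le
  have hpow : Integrable (fun n : ℕ ↦ (n : ℝ) * (1 - r : ℝ) ^ n) (geometricMeasure p) := by
    refine (integrable_natCast_geometricMeasure hp).mono' (by fun_prop) (ae_of_all _ fun n ↦ ?_)
    rw [norm_mul, norm_pow, Real.norm_natCast]
    exact mul_le_of_le_one_right n.cast_nonneg (pow_le_one₀ (norm_nonneg _) hs)
  have hinner (i : ℕ) : ∫ j : ℕ, (i : ℝ) * ((min i j : ℕ) : ℝ) ∂geometricMeasure r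
      = (1 - r) / r * (i - i * (1 - r) ^ i) := by
    rw [integral_const_mul, integral_min_geometricMeasure hr]
    ring
  rw [integral_prod _ (integrable_mul_min_geometricMeasure_prod hp hr)]
  simp_rw [hinner]
  rw [integral_const_mul, integral_sub (integrable_natCast_geometricMeasure hp) hpow,
    integral_natCast_geometricMeasure hp, integral_natCast_mul_pow_geometricMeasure hp hs]

end geometricMeasure

/-- The point probabilities `(1 - a⁻¹) a⁻ᵏ` determine a geometric law of parameter `1 - a⁻¹`. -/
lemma exists_hasLaw_geometricMeasure {Ω : Type*} [MeasurableSpace Ω] {μ : Measure Ω}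
    [IsProbabilityMeasure μ] {a : ℝ} (ha : 1 < a) {X : Ω → ℕ}
    (hX : ∀ k : ℕ, μ {ω | X ω = k} = ENNReal.ofReal ((1 - a⁻¹) * (a ^ k)⁻¹)) :
    ∃ p : unitInterval, p ≠ 0 ∧ (p : ℝ) = 1 - a⁻¹ ∧ HasLaw X (geometricMeasure p) μ := by
  have hinv : a⁻¹ < 1 := inv_lt_one_of_one_lt₀ ha
  have hinv0 : 0 < a⁻¹ := by positivity
  let p : unitInterval := ⟨1 - a⁻¹, by linarith, by linarith⟩
  have hp : p ≠ 0 := unitInterval.pos_iff_ne_zero.1 (Subtype.mk_lt_mk.2 (sub_pos.2 hinv))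
  refine ⟨p, hp, rfl, hasLaw_geometricMeasure_of_measure_fiber hp fun k ↦ (hX k).trans ?_⟩
  congr 1
  simp only [p, sub_sub_cancel, inv_pow]
  ring

/-- Let `a, b > 1` be real numbers and `X`, `X'` independent `ℕ`-valued random
variables with geometric laws of parameters `1 - a⁻¹` and `1 - b⁻¹`. Then
`Cov(X, min(X, X')) = ab / (ab - 1)²`, where `Cov(Y,Z) = E[YZ] - E[Y]·E[Z]`. -/
theorem cov_geometric_min {Ω : Type*} [MeasurableSpace Ω] (μ : Measure Ω)
    [IsProbabilityMeasure μ] (a b : ℝ) (ha : 1 < a) (hb : 1 < b)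
    (X X' : Ω → ℕ)
    (hindep : IndepFun X X' μ)
    (hX : ∀ k : ℕ, μ {ω | X ω = k} = ENNReal.ofReal ((1 - a⁻¹) * (a ^ k)⁻¹))
    (hX' : ∀ k : ℕ, μ {ω | X' ω = k} = ENNReal.ofReal ((1 - b⁻¹) * (b ^ k)⁻¹)) :
    (∫ ω, (X ω : ℝ) * ((min (X ω) (X' ω) : ℕ) : ℝ) ∂μ)
      - (∫ ω, (X ω : ℝ) ∂μ) * (∫ ω, ((min (X ω) (X' ω) : ℕ) : ℝ) ∂μ)
      = a * b / (a * b - 1) ^ 2 := by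
  obtain ⟨p, hp, hpa, hXp⟩ := exists_hasLaw_geometricMeasure ha hX
  obtain ⟨r, hr, hrb, hXr⟩ := exists_hasLaw_geometricMeasure hb hX'
  have hlaw : μ.map (fun ω ↦ (X ω, X' ω)) = (geometricMeasure p).prod (geometricMeasure r) := by
    rw [hindep.map_prod_eq_prod_map_map hXp.aemeasurable hXr.aemeasurable, hXp.map_eq, hXr.map_eq]
  have hpair : AEMeasurable (fun ω ↦ (X ω, X' ω)) μ := hXp.aemeasurable.prodMk hXr.aemeasurable
  have hmean : ∫ ω, (X ω : ℝ) ∂μ = (1 - p) / p := by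
    rw [← integral_natCast_geometricMeasure hp, ← hXp.map_eq,
      integral_map hXp.aemeasurable (by fun_prop)]
  have hmin : ∫ ω, ((min (X ω) (X' ω) : ℕ) : ℝ) ∂μ
      = (1 - r) / r * (1 - p * (1 - (1 - p) * (1 - r : ℝ))⁻¹) := by
    rw [← integral_min_geometricMeasure_prod hp hr, ← hlaw, integral_map hpair (by fun_prop)]
  have hmul : ∫ ω, (X ω : ℝ) * ((min (X ω) (X' ω) : ℕ) : ℝ) ∂μ = (1 - r) / r *
      ((1 - p) / p - p * ((1 - p) * (1 - r) / (1 - (1 - p) * (1 - r)) ^ 2)) := by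
    rw [← integral_mul_min_geometricMeasure_prod hp hr, ← hlaw, integral_map hpair (by fun_prop)]
  rw [hmul, hmean, hmin, hpa, hrb]
  have ha0 : a ≠ 0 := by positivity
  have hb0 : b ≠ 0 := by positivity
  have ha1 : a - 1 ≠ 0 := by linarith
  have hb1 : b - 1 ≠ 0 := by linarith
  have hab : a * b - 1 ≠ 0 := by nlinarith
  have hA : 1 - a⁻¹ = (a - 1) / a := by field_simp
  have hB : 1 - b⁻¹ = (b - 1) / b := by field_simp
  have hAB : 1 - a⁻¹ * b⁻¹ = (a * b - 1) / (a * b) := by field_simp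
  simp only [sub_sub_cancel]
  rw [hAB, hA, hB]
  generalize hc : a * b - 1 = c at hab ⊢
  field_simp
  rw [← hc]
  ring
end
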